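/- arXiv:1407.0988 — 2 statements merged into one kernel-verified Lean document; each statement's English description precedes it below -/
import Mathlib

section
/- With the notation of the extreme Myers–Perry conformal data and assuming additionally a ≠ b, define α = R̃₀/6 + 5K̃₀²/(6Φ₀⁶). Then α(r,θ) ≥ 0 for all r > 0, θ ∈ (0, π/2), and there is a constant C > 0 (depending only on a and b) such that 0 ≤ α(r,θ) ≤ C·r^{-6} for all r > 0, θ ∈ (0, π/2); that is, α = h·r^{-6} with h a bounded nonnegative function. -/
noncomputable section

namespace MP

/-- `Σ = r² + ab + a²cos²θ + b²sin²θ`. -/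
def Sig (a b r θ : ℝ) : ℝ :=
  r ^ 2 + a * b + a ^ 2 * Real.cos θ ^ 2 + b ^ 2 * Real.sin θ ^ 2

/-- `A = r² + ab + a²`. -/
def Afun (a b r : ℝ) : ℝ := r ^ 2 + a * b + a ^ 2

/-- `B = r² + ab + b²`. -/
def Bfun (a b r : ℝ) : ℝ := r ^ 2 + a * b + b ^ 2

/-- `σ₁₁ = a²μ sin⁴θ/Σ + A sin²θ`, with `μ = (a+b)²`. -/
def sig11 (a b r θ : ℝ) : ℝ :=
  a ^ 2 * (a + b) ^ 2 * Real.sin θ ^ 4 / Sig a b r θ + Afun a b r * Real.sin θ ^ 2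

/-- `σ₂₂ = b²μ cos⁴θ/Σ + B cos²θ`, with `μ = (a+b)²`. -/
def sig22 (a b r θ : ℝ) : ℝ :=
  b ^ 2 * (a + b) ^ 2 * Real.cos θ ^ 4 / Sig a b r θ + Bfun a b r * Real.cos θ ^ 2

/-- `σ₁₂ = abμ sin²θ cos²θ/Σ`, with `μ = (a+b)²`. -/
def sig12 (a b r θ : ℝ) : ℝ :=
  a * b * (a + b) ^ 2 * Real.sin θ ^ 2 * Real.cos θ ^ 2 / Sig a b r θ

/-- `ρ = r² sinθ cosθ (= ½ r² sin 2θ)`. -/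
def rho (r θ : ℝ) : ℝ := r ^ 2 * Real.sin θ * Real.cos θ

/-- `det σ = σ₁₁σ₂₂ − σ₁₂²`. -/
def detSig (a b r θ : ℝ) : ℝ :=
  sig11 a b r θ * sig22 a b r θ - sig12 a b r θ ^ 2

/-- The conformal factor `Φ₀ > 0`, defined by `Φ₀² = √(det σ)/ρ`. -/
def Phi0 (a b r θ : ℝ) : ℝ := Real.sqrt (Real.sqrt (detSig a b r θ) / rho r θ)

end MP


namespace MP

/-- Partial derivative in the first (radial) variable. -/
def pdr (f : ℝ → ℝ → ℝ) (r θ : ℝ) : ℝ := deriv (fun s => f s θ) r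

/-- Partial derivative in the second (angular) variable. -/
def pdt (f : ℝ → ℝ → ℝ) (r θ : ℝ) : ℝ := deriv (fun t => f r t) θ

/-- The flat four-dimensional Laplacian on biaxisymmetric functions:
`Δ₄ f = ∂²_r f + (3/r)∂_r f + r⁻²(∂²_θ f + (cot θ − tan θ)∂_θ f)`. -/
def Delta4 (f : ℝ → ℝ → ℝ) (r θ : ℝ) : ℝ :=
  pdr (pdr f) r θ + (3 / r) * pdr f r θ +
    (pdt (pdt f) r θ +
        (Real.cos θ / Real.sin θ - Real.sin θ / Real.cos θ) * pdt f r θ) / r ^ 2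

/-- Inner product of differentials in the flat two-metric `dρ² + dz²`
expressed in `(r,θ)`-coordinates:
`⟨df, dg⟩ = r⁻²(∂_r f ∂_r g + r⁻² ∂_θ f ∂_θ g)`. -/
def dInner (f g : ℝ → ℝ → ℝ) (r θ : ℝ) : ℝ :=
  (pdr f r θ * pdr g r θ + pdt f r θ * pdt g r θ / r ^ 2) / r ^ 2

/-- The flat two-dimensional Laplacian in `(r,θ)`-coordinates:
`Δ₂ f = r⁻⁴(r² ∂²_r f + r ∂_r f + ∂²_θ f)`. -/
def Delta2 (f : ℝ → ℝ → ℝ) (r θ : ℝ) : ℝ :=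
  (r ^ 2 * pdr (pdr f) r θ + r * pdr f r θ + pdt (pdt f) r θ) / r ^ 4

end MP


namespace MP

/-- `σ'₁₁ = σ₁₁/Φ₀²`. -/
def sig11' (a b : ℝ) (r θ : ℝ) : ℝ := sig11 a b r θ / Phi0 a b r θ ^ 2

/-- `σ'₂₂ = σ₂₂/Φ₀²`. -/
def sig22' (a b : ℝ) (r θ : ℝ) : ℝ := sig22 a b r θ / Phi0 a b r θ ^ 2

/-- `σ'₁₂ = σ₁₂/Φ₀²`. -/
def sig12' (a b : ℝ) (r θ : ℝ) : ℝ := sig12 a b r θ / Phi0 a b r θ ^ 2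

/-- Twist potential `ω_φ`. -/
def omegaPhi (a b : ℝ) (r θ : ℝ) : ℝ :=
  (a * (a ^ 2 - b ^ 2) * Bfun a b r * Real.cos θ ^ 2 -
      a * r ^ 2 * (2 * a ^ 2 + 2 * a * b + r ^ 2)) / (a - b) ^ 2 +
    a * Afun a b r ^ 2 * Bfun a b r / (Sig a b r θ * (a - b) ^ 2)

/-- Twist potential `ω_ψ`. -/
def omegaPsi (a b : ℝ) (r θ : ℝ) : ℝ :=
  (b * r ^ 2 * ((a + b) ^ 2 + r ^ 2) -
      b * (a ^ 2 - b ^ 2) * Afun a b r * Real.cos θ ^ 2) / (a - b) ^ 2 -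
    b * Afun a b r * Bfun a b r ^ 2 / (Sig a b r θ * (a - b) ^ 2)

/-- The squared conformal extrinsic curvature
`K̃₀² = (r²/(2ρ⁴))(σ'₁₁⟨dω_ψ,dω_ψ⟩ + σ'₂₂⟨dω_φ,dω_φ⟩ − 2σ'₁₂⟨dω_φ,dω_ψ⟩)`. -/
def Ksq (a b : ℝ) (r θ : ℝ) : ℝ :=
  r ^ 2 / (2 * rho r θ ^ 4) *
    (sig11' a b r θ * dInner (omegaPsi a b) (omegaPsi a b) r θ +
      sig22' a b r θ * dInner (omegaPhi a b) (omegaPhi a b) r θ -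
      2 * sig12' a b r θ * dInner (omegaPhi a b) (omegaPsi a b) r θ)

/-- `U = ½ log(Σ/(r⁴Φ₀²))`. -/
def Ufun (a b : ℝ) (r θ : ℝ) : ℝ :=
  Real.log (Sig a b r θ / (r ^ 4 * Phi0 a b r θ ^ 2)) / 2

/-- The rescaled scalar curvature of the conformal slice metric:
`R̃₀ = r²(−2Δ₂U + (⟨dσ'₁₁,dσ'₂₂⟩ − ⟨dσ'₁₂,dσ'₁₂⟩)/(2ρ²))`. -/
def Rt0 (a b : ℝ) (r θ : ℝ) : ℝ :=
  r ^ 2 * (-2 * Delta2 (Ufun a b) r θ +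
    (dInner (sig11' a b) (sig22' a b) r θ -
        dInner (sig12' a b) (sig12' a b) r θ) / (2 * rho r θ ^ 2))

end MP



namespace MPX

set_option linter.unusedVariables false

open Real

/-- `Σ` as a function of `p = r²`, `x = cos²θ`. -/
def S (a b p x : ℝ) : ℝ := p + a * b + a ^ 2 * x + b ^ 2 * (1 - x)

/-- `Q = Σ r⁴ Φ₀⁴`. -/
def Q (a b p x : ℝ) : ℝ :=
  p ^ 2 * S a b p x + (a + b) ^ 2 * ((p + a * b + a ^ 2) * (p + a * b + b ^ 2))

def Qp (a b p x : ℝ) : ℝ :=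
  2 * p * S a b p x + p ^ 2 + (a + b) ^ 2 * (2 * p + (a + b) ^ 2)

def Qpp (a b p x : ℝ) : ℝ :=
  2 * S a b p x + 4 * p + 2 * (a + b) ^ 2

def n11 (a b p x : ℝ) : ℝ :=
  (1 - x) * (a ^ 2 * (a + b) ^ 2 * (1 - x) + (p + a * b + a ^ 2) * S a b p x)

def n22 (a b p x : ℝ) : ℝ :=
  x * (b ^ 2 * (a + b) ^ 2 * x + (p + a * b + b ^ 2) * S a b p x)

def n12 (a b _p x : ℝ) : ℝ := a * b * (a + b) ^ 2 * (1 - x) * x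

/-- Coefficient of `p ^ 0` in the numerator of `α`. -/
def n0 (a b x y : ℝ) : ℝ :=
    24 * x ^ 3 * a ^ 10 * b ^ 2 + 156 * x ^ 3 * a ^ 9 * b ^ 3 + 432 * x ^ 3 * a ^ 8 * b ^ 4 +
    660 * x ^ 3 * a ^ 7 * b ^ 5 + 600 * x ^ 3 * a ^ 6 * b ^ 6 + 324 * x ^ 3 * a ^ 5 * b ^ 7 +
    96 * x ^ 3 * a ^ 4 * b ^ 8 + 12 * x ^ 3 * a ^ 3 * b ^ 9 + 27 * x ^ 2 * y * a ^ 10 * b ^ 2 +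
    240 * x ^ 2 * y * a ^ 9 * b ^ 3 + 876 * x ^ 2 * y * a ^ 8 * b ^ 4 +
    1728 * x ^ 2 * y * a ^ 7 * b ^ 5 + 2010 * x ^ 2 * y * a ^ 6 * b ^ 6 +
    1392 * x ^ 2 * y * a ^ 5 * b ^ 7 + 540 * x ^ 2 * y * a ^ 4 * b ^ 8 +
    96 * x ^ 2 * y * a ^ 3 * b ^ 9 + 3 * x ^ 2 * y * a ^ 2 * b ^ 10 +
    3 * x * y ^ 2 * a ^ 10 * b ^ 2 + 96 * x * y ^ 2 * a ^ 9 * b ^ 3 +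
    540 * x * y ^ 2 * a ^ 8 * b ^ 4 + 1392 * x * y ^ 2 * a ^ 7 * b ^ 5 +
    2010 * x * y ^ 2 * a ^ 6 * b ^ 6 + 1728 * x * y ^ 2 * a ^ 5 * b ^ 7 +
    876 * x * y ^ 2 * a ^ 4 * b ^ 8 + 240 * x * y ^ 2 * a ^ 3 * b ^ 9 +
    27 * x * y ^ 2 * a ^ 2 * b ^ 10 + 12 * y ^ 3 * a ^ 9 * b ^ 3 + 96 * y ^ 3 * a ^ 8 * b ^ 4 +
    324 * y ^ 3 * a ^ 7 * b ^ 5 + 600 * y ^ 3 * a ^ 6 * b ^ 6 + 660 * y ^ 3 * a ^ 5 * b ^ 7 +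
    432 * y ^ 3 * a ^ 4 * b ^ 8 + 156 * y ^ 3 * a ^ 3 * b ^ 9 + 24 * y ^ 3 * a ^ 2 * b ^ 10

/-- Coefficient of `p ^ 1` in the numerator of `α`. -/
def n1 (a b x y : ℝ) : ℝ :=
    12 * x ^ 3 * a ^ 9 * b + 192 * x ^ 3 * a ^ 8 * b ^ 2 + 816 * x ^ 3 * a ^ 7 * b ^ 3 +
    1620 * x ^ 3 * a ^ 6 * b ^ 4 + 1740 * x ^ 3 * a ^ 5 * b ^ 5 + 1032 * x ^ 3 * a ^ 4 * b ^ 6 +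
    312 * x ^ 3 * a ^ 3 * b ^ 7 + 36 * x ^ 3 * a ^ 2 * b ^ 8 + 18 * x ^ 2 * y * a ^ 9 * b +
    396 * x ^ 2 * y * a ^ 8 * b ^ 2 + 1920 * x ^ 2 * y * a ^ 7 * b ^ 3 +
    4296 * x ^ 2 * y * a ^ 6 * b ^ 4 + 5280 * x ^ 2 * y * a ^ 5 * b ^ 5 +
    3708 * x ^ 2 * y * a ^ 4 * b ^ 6 + 1416 * x ^ 2 * y * a ^ 3 * b ^ 7 +
    240 * x ^ 2 * y * a ^ 2 * b ^ 8 + 6 * x ^ 2 * y * a * b ^ 9 + 6 * x * y ^ 2 * a ^ 9 * b +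
    240 * x * y ^ 2 * a ^ 8 * b ^ 2 + 1416 * x * y ^ 2 * a ^ 7 * b ^ 3 +
    3708 * x * y ^ 2 * a ^ 6 * b ^ 4 + 5280 * x * y ^ 2 * a ^ 5 * b ^ 5 +
    4296 * x * y ^ 2 * a ^ 4 * b ^ 6 + 1920 * x * y ^ 2 * a ^ 3 * b ^ 7 +
    396 * x * y ^ 2 * a ^ 2 * b ^ 8 + 18 * x * y ^ 2 * a * b ^ 9 + 36 * y ^ 3 * a ^ 8 * b ^ 2 +
    312 * y ^ 3 * a ^ 7 * b ^ 3 + 1032 * y ^ 3 * a ^ 6 * b ^ 4 + 1740 * y ^ 3 * a ^ 5 * b ^ 5 +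
    1620 * y ^ 3 * a ^ 4 * b ^ 6 + 816 * y ^ 3 * a ^ 3 * b ^ 7 + 192 * y ^ 3 * a ^ 2 * b ^ 8 +
    12 * y ^ 3 * a * b ^ 9

/-- Coefficient of `p ^ 2` in the numerator of `α`. -/
def n2 (a b x y : ℝ) : ℝ :=
    3 * x ^ 3 * a ^ 8 + 60 * x ^ 3 * a ^ 7 * b + 510 * x ^ 3 * a ^ 6 * b ^ 2 +
    1488 * x ^ 3 * a ^ 5 * b ^ 3 + 1995 * x ^ 3 * a ^ 4 * b ^ 4 + 1320 * x ^ 3 * a ^ 3 * b ^ 5 +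
    396 * x ^ 3 * a ^ 2 * b ^ 6 + 36 * x ^ 3 * a * b ^ 7 + 6 * x ^ 2 * y * a ^ 8 +
    270 * x ^ 2 * y * a ^ 7 * b + 1620 * x ^ 2 * y * a ^ 6 * b ^ 2 +
    4158 * x ^ 2 * y * a ^ 5 * b ^ 3 + 5577 * x ^ 2 * y * a ^ 4 * b ^ 4 +
    4062 * x ^ 2 * y * a ^ 3 * b ^ 5 + 1506 * x ^ 2 * y * a ^ 2 * b ^ 6 +
    222 * x ^ 2 * y * a * b ^ 7 + 3 * x ^ 2 * y * b ^ 8 + 3 * x * y ^ 2 * a ^ 8 +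
    222 * x * y ^ 2 * a ^ 7 * b + 1506 * x * y ^ 2 * a ^ 6 * b ^ 2 +
    4062 * x * y ^ 2 * a ^ 5 * b ^ 3 + 5577 * x * y ^ 2 * a ^ 4 * b ^ 4 +
    4158 * x * y ^ 2 * a ^ 3 * b ^ 5 + 1620 * x * y ^ 2 * a ^ 2 * b ^ 6 +
    270 * x * y ^ 2 * a * b ^ 7 + 6 * x * y ^ 2 * b ^ 8 + 36 * y ^ 3 * a ^ 7 * b +
    396 * y ^ 3 * a ^ 6 * b ^ 2 + 1320 * y ^ 3 * a ^ 5 * b ^ 3 + 1995 * y ^ 3 * a ^ 4 * b ^ 4 +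
    1488 * y ^ 3 * a ^ 3 * b ^ 5 + 510 * y ^ 3 * a ^ 2 * b ^ 6 + 60 * y ^ 3 * a * b ^ 7 +
    3 * y ^ 3 * b ^ 8

/-- Coefficient of `p ^ 3` in the numerator of `α`. -/
def n3 (a b x y : ℝ) : ℝ :=
    12 * x ^ 3 * a ^ 6 + 108 * x ^ 3 * a ^ 5 * b + 600 * x ^ 3 * a ^ 4 * b ^ 2 +
    1140 * x ^ 3 * a ^ 3 * b ^ 3 + 864 * x ^ 3 * a ^ 2 * b ^ 4 + 240 * x ^ 3 * a * b ^ 5 +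
    12 * x ^ 3 * b ^ 6 + 78 * x ^ 2 * y * a ^ 6 + 660 * x ^ 2 * y * a ^ 5 * b +
    2022 * x ^ 2 * y * a ^ 4 * b ^ 2 + 3012 * x ^ 2 * y * a ^ 3 * b ^ 3 +
    2286 * x ^ 2 * y * a ^ 2 * b ^ 4 + 792 * x ^ 2 * y * a * b ^ 5 + 78 * x ^ 2 * y * b ^ 6 +
    78 * x * y ^ 2 * a ^ 6 + 792 * x * y ^ 2 * a ^ 5 * b + 2286 * x * y ^ 2 * a ^ 4 * b ^ 2 +
    3012 * x * y ^ 2 * a ^ 3 * b ^ 3 + 2022 * x * y ^ 2 * a ^ 2 * b ^ 4 +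
    660 * x * y ^ 2 * a * b ^ 5 + 78 * x * y ^ 2 * b ^ 6 + 12 * y ^ 3 * a ^ 6 +
    240 * y ^ 3 * a ^ 5 * b + 864 * y ^ 3 * a ^ 4 * b ^ 2 + 1140 * y ^ 3 * a ^ 3 * b ^ 3 +
    600 * y ^ 3 * a ^ 2 * b ^ 4 + 108 * y ^ 3 * a * b ^ 5 + 12 * y ^ 3 * b ^ 6

/-- Coefficient of `p ^ 4` in the numerator of `α`. -/
def n4 (a b x y : ℝ) : ℝ :=
    18 * x ^ 3 * a ^ 4 + 84 * x ^ 3 * a ^ 3 * b + 318 * x ^ 3 * a ^ 2 * b ^ 2 +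
    312 * x ^ 3 * a * b ^ 3 + 60 * x ^ 3 * b ^ 4 + 147 * x ^ 2 * y * a ^ 4 +
    480 * x ^ 2 * y * a ^ 3 * b + 852 * x ^ 2 * y * a ^ 2 * b ^ 2 + 708 * x ^ 2 * y * a * b ^ 3 +
    189 * x ^ 2 * y * b ^ 4 + 189 * x * y ^ 2 * a ^ 4 + 708 * x * y ^ 2 * a ^ 3 * b +
    852 * x * y ^ 2 * a ^ 2 * b ^ 2 + 480 * x * y ^ 2 * a * b ^ 3 + 147 * x * y ^ 2 * b ^ 4 +
    60 * y ^ 3 * a ^ 4 + 312 * y ^ 3 * a ^ 3 * b + 318 * y ^ 3 * a ^ 2 * b ^ 2 +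
    84 * y ^ 3 * a * b ^ 3 + 18 * y ^ 3 * b ^ 4

/-- Coefficient of `p ^ 5` in the numerator of `α`. -/
def n5 (a b x y : ℝ) : ℝ :=
    12 * x ^ 3 * a ^ 2 + 24 * x ^ 3 * a * b + 60 * x ^ 3 * b ^ 2 + 84 * x ^ 2 * y * a ^ 2 +
    72 * x ^ 2 * y * a * b + 132 * x ^ 2 * y * b ^ 2 + 132 * x * y ^ 2 * a ^ 2 +
    72 * x * y ^ 2 * a * b + 84 * x * y ^ 2 * b ^ 2 + 60 * y ^ 3 * a ^ 2 + 24 * y ^ 3 * a * b +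
    12 * y ^ 3 * b ^ 2

/-- Coefficient of `p ^ 6` in the numerator of `α`. -/
def n6 (a b x y : ℝ) : ℝ :=
    3 * x ^ 3 + 9 * x ^ 2 * y + 9 * x * y ^ 2 + 3 * y ^ 3

/-- Coefficient of `p ^ 0` in `br`. -/
def br0 (a b x : ℝ) : ℝ :=
    x ^ 2 * a ^ 12 * b ^ 2 + 6 * x ^ 2 * a ^ 11 * b ^ 3 + 13 * x ^ 2 * a ^ 10 * b ^ 4 +
    8 * x ^ 2 * a ^ 9 * b ^ 5 - 14 * x ^ 2 * a ^ 8 * b ^ 6 - 28 * x ^ 2 * a ^ 7 * b ^ 7 -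
    14 * x ^ 2 * a ^ 6 * b ^ 8 + 8 * x ^ 2 * a ^ 5 * b ^ 9 + 13 * x ^ 2 * a ^ 4 * b ^ 10 +
    6 * x ^ 2 * a ^ 3 * b ^ 11 + x ^ 2 * a ^ 2 * b ^ 12 - 3 * x * a ^ 12 * b ^ 2 -
    22 * x * a ^ 11 * b ^ 3 - 67 * x * a ^ 10 * b ^ 4 - 104 * x * a ^ 9 * b ^ 5 -
    70 * x * a ^ 8 * b ^ 6 + 28 * x * a ^ 7 * b ^ 7 + 98 * x * a ^ 6 * b ^ 8 +
    88 * x * a ^ 5 * b ^ 9 + 41 * x * a ^ 4 * b ^ 10 + 10 * x * a ^ 3 * b ^ 11 +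
    x * a ^ 2 * b ^ 12 - 2 * a ^ 11 * b ^ 3 - 18 * a ^ 10 * b ^ 4 - 72 * a ^ 9 * b ^ 5 -
    168 * a ^ 8 * b ^ 6 - 252 * a ^ 7 * b ^ 7 - 252 * a ^ 6 * b ^ 8 - 168 * a ^ 5 * b ^ 9 -
    72 * a ^ 4 * b ^ 10 - 18 * a ^ 3 * b ^ 11 - 2 * a ^ 2 * b ^ 12

/-- Coefficient of `p ^ 1` in `br`. -/
def br1 (a b x : ℝ) : ℝ :=
    2 * x ^ 2 * a ^ 11 * b + 12 * x ^ 2 * a ^ 10 * b ^ 2 + 26 * x ^ 2 * a ^ 9 * b ^ 3 +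
    16 * x ^ 2 * a ^ 8 * b ^ 4 - 28 * x ^ 2 * a ^ 7 * b ^ 5 - 56 * x ^ 2 * a ^ 6 * b ^ 6 -
    28 * x ^ 2 * a ^ 5 * b ^ 7 + 16 * x ^ 2 * a ^ 4 * b ^ 8 + 26 * x ^ 2 * a ^ 3 * b ^ 9 +
    12 * x ^ 2 * a ^ 2 * b ^ 10 + 2 * x ^ 2 * a * b ^ 11 - 6 * x * a ^ 11 * b -
    40 * x * a ^ 10 * b ^ 2 - 110 * x * a ^ 9 * b ^ 3 - 152 * x * a ^ 8 * b ^ 4 -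
    84 * x * a ^ 7 * b ^ 5 + 56 * x * a ^ 6 * b ^ 6 + 140 * x * a ^ 5 * b ^ 7 +
    120 * x * a ^ 4 * b ^ 8 + 58 * x * a ^ 3 * b ^ 9 + 16 * x * a ^ 2 * b ^ 10 +
    2 * x * a * b ^ 11 - 6 * a ^ 10 * b ^ 2 - 48 * a ^ 9 * b ^ 3 - 172 * a ^ 8 * b ^ 4 -
    364 * a ^ 7 * b ^ 5 - 504 * a ^ 6 * b ^ 6 - 476 * a ^ 5 * b ^ 7 - 308 * a ^ 4 * b ^ 8 -
    132 * a ^ 3 * b ^ 9 - 34 * a ^ 2 * b ^ 10 - 4 * a * b ^ 11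

/-- Coefficient of `p ^ 2` in `br`. -/
def br2 (a b x : ℝ) : ℝ :=
    4 * x ^ 3 * a ^ 9 * b + 8 * x ^ 3 * a ^ 8 * b ^ 2 - 8 * x ^ 3 * a ^ 7 * b ^ 3 -
    24 * x ^ 3 * a ^ 6 * b ^ 4 + 24 * x ^ 3 * a ^ 4 * b ^ 6 + 8 * x ^ 3 * a ^ 3 * b ^ 7 -
    8 * x ^ 3 * a ^ 2 * b ^ 8 - 4 * x ^ 3 * a * b ^ 9 + 4 * x ^ 2 * a ^ 9 * b +
    28 * x ^ 2 * a ^ 8 * b ^ 2 + 52 * x ^ 2 * a ^ 7 * b ^ 3 - 4 * x ^ 2 * a ^ 6 * b ^ 4 -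
    100 * x ^ 2 * a ^ 5 * b ^ 5 - 76 * x ^ 2 * a ^ 4 * b ^ 6 + 28 * x ^ 2 * a ^ 3 * b ^ 7 +
    52 * x ^ 2 * a ^ 2 * b ^ 8 + 16 * x ^ 2 * a * b ^ 9 - 3 * x * a ^ 10 - 28 * x * a ^ 9 * b -
    89 * x * a ^ 8 * b ^ 2 - 116 * x * a ^ 7 * b ^ 3 - 22 * x * a ^ 6 * b ^ 4 +
    100 * x * a ^ 5 * b ^ 5 + 102 * x * a ^ 4 * b ^ 6 + 36 * x * a ^ 3 * b ^ 7 +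
    9 * x * a ^ 2 * b ^ 8 + 8 * x * a * b ^ 9 + 3 * x * b ^ 10 - 6 * a ^ 9 * b -
    50 * a ^ 8 * b ^ 2 - 178 * a ^ 7 * b ^ 3 - 361 * a ^ 6 * b ^ 4 - 468 * a ^ 5 * b ^ 5 -
    411 * a ^ 4 * b ^ 6 - 250 * a ^ 3 * b ^ 7 - 103 * a ^ 2 * b ^ 8 - 26 * a * b ^ 9 - 3 * b ^ 10

/-- Coefficient of `p ^ 3` in `br`. -/
def br3 (a b x : ℝ) : ℝ :=
    20 * x ^ 2 * a ^ 7 * b + 40 * x ^ 2 * a ^ 6 * b ^ 2 - 20 * x ^ 2 * a ^ 5 * b ^ 3 -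
    80 * x ^ 2 * a ^ 4 * b ^ 4 - 20 * x ^ 2 * a ^ 3 * b ^ 5 + 40 * x ^ 2 * a ^ 2 * b ^ 6 +
    20 * x ^ 2 * a * b ^ 7 - 10 * x * a ^ 8 - 44 * x * a ^ 7 * b - 36 * x * a ^ 6 * b ^ 2 +
    60 * x * a ^ 5 * b ^ 3 + 80 * x * a ^ 4 * b ^ 4 - 20 * x * a ^ 3 * b ^ 5 -
    44 * x * a ^ 2 * b ^ 6 + 4 * x * a * b ^ 7 + 10 * x * b ^ 8 - 2 * a ^ 8 - 28 * a ^ 7 * b -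
    114 * a ^ 6 * b ^ 2 - 220 * a ^ 5 * b ^ 3 - 242 * a ^ 4 * b ^ 4 - 180 * a ^ 3 * b ^ 5 -
    110 * a ^ 2 * b ^ 6 - 52 * a * b ^ 7 - 12 * b ^ 8

/-- Coefficient of `p ^ 4` in `br`. -/
def br4 (a b x : ℝ) : ℝ :=
    -x ^ 2 * a ^ 6 + 6 * x ^ 2 * a ^ 5 * b + x ^ 2 * a ^ 4 * b ^ 2 - 12 * x ^ 2 * a ^ 3 * b ^ 3 +
    x ^ 2 * a ^ 2 * b ^ 4 + 6 * x ^ 2 * a * b ^ 5 - x ^ 2 * b ^ 6 - 9 * x * a ^ 6 -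
    2 * x * a ^ 5 * b + 37 * x * a ^ 4 * b ^ 2 + 12 * x * a ^ 3 * b ^ 3 - 39 * x * a ^ 2 * b ^ 4 -
    10 * x * a * b ^ 5 + 11 * x * b ^ 6 - 8 * a ^ 6 - 44 * a ^ 5 * b - 78 * a ^ 4 * b ^ 2 -
    60 * a ^ 3 * b ^ 3 - 40 * a ^ 2 * b ^ 4 - 40 * a * b ^ 5 - 18 * b ^ 6

/-- Coefficient of `p ^ 5` in `br`. -/
def br5 (a b x : ℝ) : ℝ :=
    -4 * x * a ^ 4 + 8 * x * a ^ 3 * b - 8 * x * a * b ^ 3 + 4 * x * b ^ 4 - 8 * a ^ 4 -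
    16 * a ^ 3 * b - 4 * a ^ 2 * b ^ 2 - 8 * a * b ^ 3 - 12 * b ^ 4

/-- Coefficient of `p ^ 6` in `br`. -/
def br6 (a b x : ℝ) : ℝ :=
    -3 * a ^ 2 + 2 * a * b - 3 * b ^ 2

def br (a b p x : ℝ) : ℝ :=
  (a + b) ^ 2 * (br0 a b x * p ^ 0 +
    br1 a b x * p ^ 1 +
    br2 a b x * p ^ 2 +
    br3 a b x * p ^ 3 +
    br4 a b x * p ^ 4 +
    br5 a b x * p ^ 5 +
    br6 a b x * p ^ 6)

/-- Coefficient of `p ^ 0` in `Kn`. -/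
def Kn0 (a b x : ℝ) : ℝ :=
    x ^ 2 * a ^ 10 * b ^ 2 + 4 * x ^ 2 * a ^ 9 * b ^ 3 + 4 * x ^ 2 * a ^ 8 * b ^ 4 -
    4 * x ^ 2 * a ^ 7 * b ^ 5 - 10 * x ^ 2 * a ^ 6 * b ^ 6 - 4 * x ^ 2 * a ^ 5 * b ^ 7 +
    4 * x ^ 2 * a ^ 4 * b ^ 8 + 4 * x ^ 2 * a ^ 3 * b ^ 9 + x ^ 2 * a ^ 2 * b ^ 10 +
    2 * x * a ^ 9 * b ^ 3 + 10 * x * a ^ 8 * b ^ 4 + 18 * x * a ^ 7 * b ^ 5 +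
    10 * x * a ^ 6 * b ^ 6 - 10 * x * a ^ 5 * b ^ 7 - 18 * x * a ^ 4 * b ^ 8 -
    10 * x * a ^ 3 * b ^ 9 - 2 * x * a ^ 2 * b ^ 10 + a ^ 9 * b ^ 3 + 7 * a ^ 8 * b ^ 4 +
    21 * a ^ 7 * b ^ 5 + 35 * a ^ 6 * b ^ 6 + 35 * a ^ 5 * b ^ 7 + 21 * a ^ 4 * b ^ 8 +
    7 * a ^ 3 * b ^ 9 + a ^ 2 * b ^ 10

/-- Coefficient of `p ^ 1` in `Kn`. -/
def Kn1 (a b x : ℝ) : ℝ :=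
    4 * x * a ^ 8 * b ^ 2 + 16 * x * a ^ 7 * b ^ 3 + 20 * x * a ^ 6 * b ^ 4 -
    20 * x * a ^ 4 * b ^ 6 - 16 * x * a ^ 3 * b ^ 7 - 4 * x * a ^ 2 * b ^ 8 + 3 * a ^ 8 * b ^ 2 +
    22 * a ^ 7 * b ^ 3 + 65 * a ^ 6 * b ^ 4 + 100 * a ^ 5 * b ^ 5 + 85 * a ^ 4 * b ^ 6 +
    38 * a ^ 3 * b ^ 7 + 7 * a ^ 2 * b ^ 8

/-- Coefficient of `p ^ 2` in `Kn`. -/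
def Kn2 (a b x : ℝ) : ℝ :=
    -2 * x ^ 3 * a ^ 7 * b + 6 * x ^ 3 * a ^ 5 * b ^ 3 - 6 * x ^ 3 * a ^ 3 * b ^ 5 +
    2 * x ^ 3 * a * b ^ 7 - 5 * x ^ 2 * a ^ 7 * b - 16 * x ^ 2 * a ^ 6 * b ^ 2 -
    x ^ 2 * a ^ 5 * b ^ 3 + 32 * x ^ 2 * a ^ 4 * b ^ 4 + 17 * x ^ 2 * a ^ 3 * b ^ 5 -
    16 * x ^ 2 * a ^ 2 * b ^ 6 - 11 * x ^ 2 * a * b ^ 7 + 4 * x * a ^ 7 * b +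
    8 * x * a ^ 6 * b ^ 2 - 12 * x * a ^ 5 * b ^ 3 - 32 * x * a ^ 4 * b ^ 4 -
    4 * x * a ^ 3 * b ^ 5 + 24 * x * a ^ 2 * b ^ 6 + 12 * x * a * b ^ 7 + 3 * a ^ 7 * b +
    27 * a ^ 6 * b ^ 2 + 82 * a ^ 5 * b ^ 3 + 114 * a ^ 4 * b ^ 4 + 75 * a ^ 3 * b ^ 5 +
    19 * a ^ 2 * b ^ 6

/-- Coefficient of `p ^ 3` in `Kn`. -/
def Kn3 (a b x : ℝ) : ℝ :=
    -3 * x ^ 2 * a ^ 6 - 16 * x ^ 2 * a ^ 5 * b + 3 * x ^ 2 * a ^ 4 * b ^ 2 +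
    32 * x ^ 2 * a ^ 3 * b ^ 3 + 3 * x ^ 2 * a ^ 2 * b ^ 4 - 16 * x ^ 2 * a * b ^ 5 -
    3 * x ^ 2 * b ^ 6 + 2 * x * a ^ 6 - 32 * x * a ^ 4 * b ^ 2 - 32 * x * a ^ 3 * b ^ 3 +
    26 * x * a ^ 2 * b ^ 4 + 32 * x * a * b ^ 5 + 4 * x * b ^ 6 + a ^ 6 + 16 * a ^ 5 * b +
    54 * a ^ 4 * b ^ 2 + 64 * a ^ 3 * b ^ 3 + 25 * a ^ 2 * b ^ 4

/-- Coefficient of `p ^ 4` in `Kn`. -/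
def Kn4 (a b x : ℝ) : ℝ :=
    -4 * x ^ 2 * a ^ 4 + 8 * x ^ 2 * a ^ 2 * b ^ 2 - 4 * x ^ 2 * b ^ 4 - 20 * x * a ^ 3 * b -
    8 * x * a ^ 2 * b ^ 2 + 20 * x * a * b ^ 3 + 8 * x * b ^ 4 + 4 * a ^ 4 + 20 * a ^ 3 * b +
    16 * a ^ 2 * b ^ 2

/-- Coefficient of `p ^ 5` in `Kn`. -/
def Kn5 (a b x : ℝ) : ℝ :=
    -4 * x * a ^ 2 + 4 * x * b ^ 2 + 4 * a ^ 2

def Kn (a b p x : ℝ) : ℝ :=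
  (a + b) ^ 4 * (Kn0 a b x * p ^ 0 +
    Kn1 a b x * p ^ 1 +
    Kn2 a b x * p ^ 2 +
    Kn3 a b x * p ^ 3 +
    Kn4 a b x * p ^ 4 +
    Kn5 a b x * p ^ 5)

lemma n_det (a b p x : ℝ) : n11 a b p x * n22 a b p x - n12 a b p x ^ 2
    = x * (1 - x) * (Q a b p x * S a b p x) := by
  unfold n11 n22 n12 Q S; ring

/-! Elementary derivatives -/

lemma dS_p (a b p x : ℝ) : HasDerivAt (fun p => S a b p x) 1 p := by
  unfold S
  exact ((((hasDerivAt_id p).add_const (a*b)).add_const (a^2*x)).add_const (b^2*(1-x)))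

lemma dS_x (a b p x : ℝ) : HasDerivAt (fun x => S a b p x) (a^2-b^2) x := by
  unfold S
  have := (((hasDerivAt_id x).const_mul (a^2)).const_add (p+a*b)).add
    (((hasDerivAt_id x).const_sub 1).const_mul (b^2))
  refine this.congr_deriv ?_
  ring

lemma dA (u p : ℝ) (v : ℝ) : HasDerivAt (fun p : ℝ => p + u + v) 1 p :=
  ((hasDerivAt_id p).add_const u).add_const v

lemma dQ_p (a b p x : ℝ) : HasDerivAt (fun p => Q a b p x) (Qp a b p x) p := by
  have := (((hasDerivAt_id p).pow 2).mul (dS_p a b p x)).add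
    (((dA (a*b) p (a^2)).mul (dA (a*b) p (b^2))).const_mul ((a+b)^2))
  refine this.congr_deriv ?_
  simp only [Qp, id, Pi.pow_apply]; ring

lemma dQp_p (a b p x : ℝ) : HasDerivAt (fun p => Qp a b p x) (Qpp a b p x) p := by
  have := ((((hasDerivAt_id p).const_mul 2).mul (dS_p a b p x)).add ((hasDerivAt_id p).pow 2)).add
    ((((hasDerivAt_id p).const_mul 2).add_const ((a+b)^2)).const_mul ((a+b)^2))
  refine this.congr_deriv ?_
  simp only [Qpp, id]; ring

lemma dQ_x (a b p x : ℝ) : HasDerivAt (fun x => Q a b p x) ((a^2-b^2) * p^2) x := by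
  have := ((dS_x a b p x).const_mul (p^2)).add_const
    ((a + b) ^ 2 * ((p + a * b + a ^ 2) * (p + a * b + b ^ 2)))
  refine this.congr_deriv ?_
  ring

def n11p (a b p x : ℝ) : ℝ := (1 - x) * (S a b p x + (p + a * b + a ^ 2))
def n22p (a b p x : ℝ) : ℝ := x * (S a b p x + (p + a * b + b ^ 2))
def n11x (a b p x : ℝ) : ℝ :=
  -(a ^ 2 * (a + b) ^ 2 * (1 - x) + (p + a * b + a ^ 2) * S a b p x)
    + (1 - x) * (-(a ^ 2 * (a + b) ^ 2) + (p + a * b + a ^ 2) * (a ^ 2 - b ^ 2))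
def n22x (a b p x : ℝ) : ℝ :=
  (b ^ 2 * (a + b) ^ 2 * x + (p + a * b + b ^ 2) * S a b p x)
    + x * (b ^ 2 * (a + b) ^ 2 + (p + a * b + b ^ 2) * (a ^ 2 - b ^ 2))
def n12x (a b x : ℝ) : ℝ := a * b * (a + b) ^ 2 * (1 - 2 * x)

lemma dn11_p (a b p x : ℝ) : HasDerivAt (fun p => n11 a b p x) (n11p a b p x) p := by
  have := (((dA (a*b) p (a^2)).mul (dS_p a b p x)).const_add
    (a ^ 2 * (a + b) ^ 2 * (1 - x))).const_mul (1 - x)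
  refine this.congr_deriv ?_
  simp [n11p]

lemma dn22_p (a b p x : ℝ) : HasDerivAt (fun p => n22 a b p x) (n22p a b p x) p := by
  have := (((dA (a*b) p (b^2)).mul (dS_p a b p x)).const_add
    (b ^ 2 * (a + b) ^ 2 * x)).const_mul x
  refine this.congr_deriv ?_
  simp [n22p]

lemma dn12_p (a b p x : ℝ) : HasDerivAt (fun p => n12 a b p x) 0 p :=
  hasDerivAt_const p _

lemma dn11_x (a b p x : ℝ) : HasDerivAt (fun x => n11 a b p x) (n11x a b p x) x := by
  have h1 : HasDerivAt (fun x : ℝ => 1 - x) (-1) x := (hasDerivAt_id x).const_sub 1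
  have := h1.mul ((h1.const_mul (a ^ 2 * (a + b) ^ 2)).add
    ((dS_x a b p x).const_mul (p + a*b+a^2)))
  refine this.congr_deriv ?_
  simp [n11x]

lemma dn22_x (a b p x : ℝ) : HasDerivAt (fun x => n22 a b p x) (n22x a b p x) x := by
  have h1 : HasDerivAt (fun x : ℝ => x) 1 x := hasDerivAt_id x
  have := h1.mul ((h1.const_mul (b ^ 2 * (a + b) ^ 2)).add
    ((dS_x a b p x).const_mul (p + a*b+b^2)))
  refine this.congr_deriv ?_
  simp [n22x]

lemma dn12_x (a b p x : ℝ) : HasDerivAt (fun x => n12 a b p x) (n12x a b x) x := by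
  have h1 : HasDerivAt (fun x : ℝ => 1 - x) (-1) x := (hasDerivAt_id x).const_sub 1
  have h2 : HasDerivAt (fun x : ℝ => x) 1 x := hasDerivAt_id x
  have := (h1.const_mul (a * b * (a+b)^2)).mul h2
  refine this.congr_deriv ?_
  simp [n12x]; ring

/-- Derivative of `M / √W`. -/
lemma d_div_sqrt {M W : ℝ → ℝ} {M' W' t : ℝ} (hM : HasDerivAt M M' t) (hW : HasDerivAt W W' t)
    (hpos : 0 < W t) : HasDerivAt (fun t => M t / √(W t))
      ((2 * M' * W t - M t * W') / (2 * W t * √(W t))) t := by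
  have h := hM.div (hW.sqrt hpos.ne') (sqrt_ne_zero'.2 hpos)
  refine h.congr_deriv ?_
  have h2 : √(W t) ^ 2 = W t := sq_sqrt hpos.le
  have h3 : √(W t) ≠ 0 := sqrt_ne_zero'.2 hpos
  have h4 := hpos.ne'
  rw [h2]
  field_simp
  rw [h2]
  ring

/-! Twist potentials -/

def omP (a b p x : ℝ) : ℝ :=
  (a * (a ^ 2 - b ^ 2) * (p + a * b + b ^ 2) * x -
      a * p * (2 * a ^ 2 + 2 * a * b + p)) / (a - b) ^ 2 +
    a * (p + a * b + a ^ 2) ^ 2 * (p + a * b + b ^ 2) / (S a b p x * (a - b) ^ 2)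

def omQ (a b p x : ℝ) : ℝ :=
  (b * p * ((a + b) ^ 2 + p) -
      b * (a ^ 2 - b ^ 2) * (p + a * b + a ^ 2) * x) / (a - b) ^ 2 -
    b * (p + a * b + a ^ 2) * (p + a * b + b ^ 2) ^ 2 / (S a b p x * (a - b) ^ 2)

lemma dsome (a b p x : ℝ) (hab : a - b ≠ 0) (hS : S a b p x ≠ 0) :
    HasDerivAt (fun p => omP a b p x)
      (a * x * (1 - x) ^ 2 * ((a - b) * (a + b) ^ 3) / S a b p x ^ 2) p ∧
    HasDerivAt (fun x => omP a b p x)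
      (-(a * (1 - x) * ((a + b) ^ 2 * (p + a * b + b ^ 2) *
        (S a b p x + (p + a * b + a ^ 2)))) / S a b p x ^ 2) x ∧
    HasDerivAt (fun p => omQ a b p x)
      (b * x ^ 2 * (1 - x) * ((a - b) * (a + b) ^ 3) / S a b p x ^ 2) p ∧
    HasDerivAt (fun x => omQ a b p x)
      (-(b * x * ((a + b) ^ 2 * (p + a * b + a ^ 2) *
        (S a b p x + (p + a * b + b ^ 2)))) / S a b p x ^ 2) x := by
  have hp : HasDerivAt (fun p : ℝ => p) 1 p := hasDerivAt_id p
  have hx : HasDerivAt (fun x : ℝ => x) 1 x := hasDerivAt_id x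
  have hA := dA (a * b) p (a ^ 2)
  have hB := dA (a * b) p (b ^ 2)
  have hSp := dS_p a b p x
  have hSx := dS_x a b p x
  have hne : S a b p x * (a - b) ^ 2 ≠ 0 := mul_ne_zero hS (pow_ne_zero 2 hab)
  refine ⟨?_, ?_, ?_, ?_⟩
  · have := (((hB.const_mul (a * (a ^ 2 - b ^ 2))).mul_const x).sub
      ((hp.const_mul a).mul (hp.const_add (2 * a ^ 2 + 2 * a * b)))).div_const ((a - b) ^ 2) |>.add
      ((((hA.pow 2).const_mul a).mul hB).div (hSp.mul_const ((a - b) ^ 2)) hne)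
    refine this.congr_deriv ?_
    simp only [Pi.pow_apply, Pi.mul_apply]
    field_simp
    unfold S
    ring
  · have := (((hx.const_mul (a * (a ^ 2 - b ^ 2) * (p + a * b + b ^ 2))).sub_const
      (a * p * (2 * a ^ 2 + 2 * a * b + p))).div_const ((a - b) ^ 2)).add
      ((hasDerivAt_const x (a * (p + a * b + a ^ 2) ^ 2 * (p + a * b + b ^ 2))).div
        (hSx.mul_const ((a - b) ^ 2)) hne)
    refine this.congr_deriv ?_
    field_simp
    unfold S
    ring
  · have := (((hp.const_mul b).mul (hp.const_add ((a + b) ^ 2))).sub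
      ((hA.const_mul (b * (a ^ 2 - b ^ 2))).mul_const x)).div_const ((a - b) ^ 2) |>.sub
      (((hA.const_mul b).mul (hB.pow 2)).div (hSp.mul_const ((a - b) ^ 2)) hne)
    refine this.congr_deriv ?_
    simp only [Pi.pow_apply, Pi.mul_apply]
    field_simp
    unfold S
    ring
  · have := (((hx.const_mul (b * (a ^ 2 - b ^ 2) * (p + a * b + a ^ 2))).const_sub
      (b * p * ((a + b) ^ 2 + p))).div_const ((a - b) ^ 2)).sub
      ((hasDerivAt_const x (b * (p + a * b + a ^ 2) * (p + a * b + b ^ 2) ^ 2)).div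
        (hSx.mul_const ((a - b) ^ 2)) hne)
    refine this.congr_deriv ?_
    field_simp
    unfold S
    ring

/-! Algebraic identities -/

set_option maxHeartbeats 4000000 in
lemma K_id (a b p x : ℝ) :
    n11 a b p x * (p ^ 2 * (b * x ^ 2 * (1 - x) * ((a - b) * (a + b) ^ 3)) ^ 2
      + x * (1 - x) * (-(b * x * ((a + b) ^ 2 * (p + a * b + a ^ 2) *
        (S a b p x + (p + a * b + b ^ 2))))) ^ 2)
    + n22 a b p x * (p ^ 2 * (a * x * (1 - x) ^ 2 * ((a - b) * (a + b) ^ 3)) ^ 2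
      + x * (1 - x) * (-(a * (1 - x) * ((a + b) ^ 2 * (p + a * b + b ^ 2) *
        (S a b p x + (p + a * b + a ^ 2))))) ^ 2)
    - 2 * n12 a b p x * (p ^ 2 * ((a * x * (1 - x) ^ 2 * ((a - b) * (a + b) ^ 3))
        * (b * x ^ 2 * (1 - x) * ((a - b) * (a + b) ^ 3)))
      + x * (1 - x) * ((-(a * (1 - x) * ((a + b) ^ 2 * (p + a * b + b ^ 2) *
        (S a b p x + (p + a * b + a ^ 2))))) * (-(b * x * ((a + b) ^ 2 * (p + a * b + a ^ 2) *
        (S a b p x + (p + a * b + b ^ 2)))))))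
    = x ^ 2 * (1 - x) ^ 2 * S a b p x * Kn a b p x := by
  unfold n11 n22 n12 Kn Kn0 Kn1 Kn2 Kn3 Kn4 Kn5 S
  ring

/-- numerator of `Δ log Σ` -/
def LS (a b p x : ℝ) : ℝ :=
  4 * (p * S a b p x - p ^ 2) - 4 * x * (1 - x) * (a ^ 2 - b ^ 2) ^ 2
    - 2 * (2 * x - 1) * (a ^ 2 - b ^ 2) * S a b p x

def LQ (a b p x : ℝ) : ℝ :=
  4 * ((p * Qp a b p x + p ^ 2 * Qpp a b p x) * Q a b p x - p ^ 2 * Qp a b p x ^ 2)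
    - 4 * x * (1 - x) * ((a ^ 2 - b ^ 2) * p ^ 2) ^ 2
    - 2 * (2 * x - 1) * ((a ^ 2 - b ^ 2) * p ^ 2) * Q a b p x

/-- total numerator -/
def N (a b p x y : ℝ) : ℝ :=
  n0 a b x y + n1 a b x y * p + n2 a b x y * p ^ 2 + n3 a b x y * p ^ 3 + n4 a b x y * p ^ 4
    + n5 a b x y * p ^ 5 + n6 a b x y * p ^ 6

set_option maxHeartbeats 4000000 in
lemma N_id (a b p x : ℝ) :
    -3 * LS a b p x * Q a b p x ^ 2 + LQ a b p x * S a b p x ^ 2 + br a b p x + 20 * Kn a b p x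
      = (a + b) ^ 4 * N a b p x (1 - x) := by
  unfold LS LQ N Qp Qpp Q S br Kn br0 br1 br2 br3 br4 br5 br6 Kn0 Kn1 Kn2 Kn3 Kn4 Kn5 n0 n1 n2 n3 n4 n5 n6
  ring

set_option maxHeartbeats 4000000 in
lemma br_id (a b p x : ℝ) :
    p ^ 2 * (4 * (Q a b p x * S a b p x) *
        ((n11p a b p x * p + n11 a b p x) * (n22p a b p x * p + n22 a b p x) - n12 a b p x ^ 2)
      - 2 * (Q a b p x * S a b p x) * (Qp a b p x * S a b p x + Q a b p x) * (2 * p * x * (1 - x))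
      - p ^ 2 * x * (1 - x) * (Qp a b p x * S a b p x + Q a b p x) ^ 2)
    + x * (1 - x) * (4 * (Q a b p x * S a b p x) *
        ((n11x a b p x * p) * (n22x a b p x * p) - (n12x a b x * p) ^ 2)
      - 2 * (Q a b p x * S a b p x) * ((a ^ 2 - b ^ 2) * p ^ 2 * S a b p x
          + Q a b p x * (a ^ 2 - b ^ 2)) * (p ^ 2 * (1 - 2 * x))
      - p ^ 2 * x * (1 - x) * ((a ^ 2 - b ^ 2) * p ^ 2 * S a b p x
          + Q a b p x * (a ^ 2 - b ^ 2)) ^ 2)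
    = p ^ 2 * x * (1 - x) * br a b p x := by
  unfold n11p n22p n11x n22x n12x n11 n22 n12 Qp Q S br br0 br1 br2 br3 br4 br5 br6
  ring

/-! Chain rule in `p = r²`, `x = cos²θ` -/

open MP

lemma trig_dom {θ : ℝ} (hθ : θ ∈ Set.Ioo 0 (π / 2)) :
    0 < sin θ ∧ 0 < cos θ ∧ 0 < cos θ ^ 2 ∧ cos θ ^ 2 < 1 := by
  have hs : 0 < sin θ := sin_pos_of_pos_of_lt_pi hθ.1 (by linarith [hθ.2, pi_pos])
  have hc : 0 < cos θ := cos_pos_of_mem_Ioo ⟨by linarith [hθ.1, pi_pos], hθ.2⟩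
  refine ⟨hs, hc, by positivity, ?_⟩
  nlinarith [sin_sq_add_cos_sq θ]

lemma cos_sq_deriv (θ : ℝ) : HasDerivAt (fun t => cos t ^ 2) (-(2 * sin θ * cos θ)) θ := by
  refine ((hasDerivAt_cos θ).pow 2).congr_deriv ?_
  simp; ring

lemma sq_deriv (r : ℝ) : HasDerivAt (fun t : ℝ => t ^ 2) (2 * r) r := by
  simpa using hasDerivAt_pow 2 r

lemma pdr_chain {f G : ℝ → ℝ → ℝ} {G' r θ : ℝ} (hr : 0 < r) (hθ : θ ∈ Set.Ioo 0 (π / 2))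
    (h : ∀ s t : ℝ, 0 < s → t ∈ Set.Ioo 0 (π / 2) → f s t = G (s ^ 2) (cos t ^ 2))
    (hG : HasDerivAt (fun p => G p (cos θ ^ 2)) G' (r ^ 2)) : pdr f r θ = 2 * r * G' := by
  have h1 : HasDerivAt (fun s : ℝ => G (s ^ 2) (cos θ ^ 2)) (G' * (2 * r)) r :=
    HasDerivAt.comp (h₂ := fun p => G p (cos θ ^ 2)) r hG (sq_deriv r)
  have h2 : (fun s => f s θ) =ᶠ[nhds r] fun s : ℝ => G (s ^ 2) (cos θ ^ 2) := by
    filter_upwards [lt_mem_nhds hr] with s hs using h s θ hs hθ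
  unfold pdr
  rw [h2.deriv_eq, h1.deriv]; ring

lemma pdt_chain {f G : ℝ → ℝ → ℝ} {G' r θ : ℝ} (hr : 0 < r) (hθ : θ ∈ Set.Ioo 0 (π / 2))
    (h : ∀ s t : ℝ, 0 < s → t ∈ Set.Ioo 0 (π / 2) → f s t = G (s ^ 2) (cos t ^ 2))
    (hG : HasDerivAt (fun x => G (r ^ 2) x) G' (cos θ ^ 2)) :
    pdt f r θ = -(2 * sin θ * cos θ) * G' := by
  have h1 : HasDerivAt (fun t : ℝ => G (r ^ 2) (cos t ^ 2)) (G' * (-(2 * sin θ * cos θ))) θ :=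
    HasDerivAt.comp (h₂ := fun x => G (r ^ 2) x) θ hG (cos_sq_deriv θ)
  have h2 : (fun t => f r t) =ᶠ[nhds θ] fun t : ℝ => G (r ^ 2) (cos t ^ 2) := by
    filter_upwards [Ioo_mem_nhds hθ.1 hθ.2] with t ht using h r t hr ht
  unfold pdt
  rw [h2.deriv_eq, h1.deriv]; ring

/-- `f` is the function `G` of `p = r²`, `x = cos²θ`, with partial derivatives `fp`, `fx` at
the given point. -/
def Rep (f G : ℝ → ℝ → ℝ) (fp fx r θ : ℝ) : Prop :=
  (∀ s t : ℝ, 0 < s → t ∈ Set.Ioo 0 (π / 2) → f s t = G (s ^ 2) (cos t ^ 2)) ∧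
  HasDerivAt (fun p => G p (cos θ ^ 2)) fp (r ^ 2) ∧
  HasDerivAt (fun x => G (r ^ 2) x) fx (cos θ ^ 2)

lemma dInner_chain {f g F G : ℝ → ℝ → ℝ} {fp fx gp gx r θ : ℝ} (hr : 0 < r)
    (hθ : θ ∈ Set.Ioo 0 (π / 2)) (hf : Rep f F fp fx r θ) (hg : Rep g G gp gx r θ) :
    dInner f g r θ = 4 / (r ^ 2) ^ 2 *
      ((r ^ 2) ^ 2 * (fp * gp) + cos θ ^ 2 * (1 - cos θ ^ 2) * (fx * gx)) := by
  unfold dInner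
  rw [pdr_chain hr hθ hf.1 hf.2.1, pdr_chain hr hθ hg.1 hg.2.1,
    pdt_chain hr hθ hf.1 hf.2.2, pdt_chain hr hθ hg.1 hg.2.2, ← sin_sq]
  field_simp
  ring

lemma Delta2_chain {f G Gp Gx : ℝ → ℝ → ℝ} {gpp gxx r θ : ℝ} (hr : 0 < r)
    (hθ : θ ∈ Set.Ioo 0 (π / 2))
    (h : ∀ s t : ℝ, 0 < s → t ∈ Set.Ioo 0 (π / 2) → f s t = G (s ^ 2) (cos t ^ 2))
    (hp : ∀ p x : ℝ, 0 < p → 0 < x → x < 1 → HasDerivAt (fun p => G p x) (Gp p x) p)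
    (hx : ∀ p x : ℝ, 0 < p → 0 < x → x < 1 → HasDerivAt (fun x => G p x) (Gx p x) x)
    (hpp : HasDerivAt (fun p => Gp p (cos θ ^ 2)) gpp (r ^ 2))
    (hxx : HasDerivAt (fun x => Gx (r ^ 2) x) gxx (cos θ ^ 2)) :
    Delta2 f r θ = 1 / (r ^ 2) ^ 2 * (4 * (r ^ 2) * Gp (r ^ 2) (cos θ ^ 2)
      + 4 * (r ^ 2) ^ 2 * gpp + 4 * cos θ ^ 2 * (1 - cos θ ^ 2) * gxx
      - 2 * (2 * cos θ ^ 2 - 1) * Gx (r ^ 2) (cos θ ^ 2)) := by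
  have er : ∀ s t : ℝ, 0 < s → t ∈ Set.Ioo 0 (π / 2) →
      pdr f s t = 2 * s * Gp (s ^ 2) (cos t ^ 2) := fun s t hs ht =>
    pdr_chain hs ht h (hp _ _ (by positivity) (trig_dom ht).2.2.1 (trig_dom ht).2.2.2)
  have et : ∀ s t : ℝ, 0 < s → t ∈ Set.Ioo 0 (π / 2) →
      pdt f s t = -(2 * sin t * cos t) * Gx (s ^ 2) (cos t ^ 2) := fun s t hs ht =>
    pdt_chain hs ht h (hx _ _ (by positivity) (trig_dom ht).2.2.1 (trig_dom ht).2.2.2)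
  have e1 : pdr (pdr f) r θ = 2 * Gp (r ^ 2) (cos θ ^ 2) + 4 * r ^ 2 * gpp := by
    have h1 : HasDerivAt (fun s : ℝ => Gp (s ^ 2) (cos θ ^ 2)) (gpp * (2 * r)) r :=
      HasDerivAt.comp (h₂ := fun p => Gp p (cos θ ^ 2)) r hpp (sq_deriv r)
    have h3 : HasDerivAt (fun s : ℝ => 2 * s) 2 r := by
      simpa using (hasDerivAt_id r).const_mul 2
    have h2 : (fun s => pdr f s θ) =ᶠ[nhds r]
        ((fun s : ℝ => 2 * s) * fun s : ℝ => Gp (s ^ 2) (cos θ ^ 2)) := by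
      filter_upwards [lt_mem_nhds hr] with s hs using er s θ hs hθ
    rw [show pdr (pdr f) r θ = deriv (fun s => pdr f s θ) r from rfl, h2.deriv_eq,
      (h3.mul h1).deriv]
    ring
  have e2 : pdt (pdt f) r θ = -(2 * (cos θ ^ 2 - sin θ ^ 2)) * Gx (r ^ 2) (cos θ ^ 2)
      + 4 * sin θ ^ 2 * cos θ ^ 2 * gxx := by
    have h1 : HasDerivAt (fun t : ℝ => Gx (r ^ 2) (cos t ^ 2)) (gxx * (-(2 * sin θ * cos θ))) θ :=
      HasDerivAt.comp (h₂ := fun x => Gx (r ^ 2) x) θ hxx (cos_sq_deriv θ)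
    have h3 : HasDerivAt (fun t : ℝ => -(2 * sin t * cos t))
        (-(2 * (cos θ ^ 2 - sin θ ^ 2))) θ := by
      refine (((hasDerivAt_sin θ).const_mul 2).mul (hasDerivAt_cos θ)).neg.congr_deriv ?_
      ring
    have h2 : (fun t => pdt f r t) =ᶠ[nhds θ]
        ((fun t : ℝ => -(2 * sin t * cos t)) * fun t : ℝ => Gx (r ^ 2) (cos t ^ 2)) := by
      filter_upwards [Ioo_mem_nhds hθ.1 hθ.2] with t ht using et r t hr ht
    rw [show pdt (pdt f) r θ = deriv (fun t => pdt f r t) θ from rfl, h2.deriv_eq,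
      (h3.mul h1).deriv]
    ring
  unfold Delta2
  rw [e1, e2, er r θ hr hθ, sin_sq]
  field_simp
  ring

/-! Positivity -/

lemma S_pos {a b p x : ℝ} (ha : 0 < a) (hb : 0 < b) (hp : 0 < p) (hx : 0 < x) (hx1 : x < 1) :
    0 < S a b p x := by
  have : 0 < 1 - x := by linarith
  unfold S; positivity

lemma Q_pos {a b p x : ℝ} (ha : 0 < a) (hb : 0 < b) (hp : 0 < p) (hx : 0 < x) (hx1 : x < 1) :
    0 < Q a b p x := by
  have := S_pos ha hb hp hx hx1
  unfold Q; positivity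

/-! Representation of the data -/

lemma Sig_eq (a b r θ : ℝ) : Sig a b r θ = S a b (r ^ 2) (cos θ ^ 2) := by
  unfold Sig S; rw [sin_sq]

lemma sig11_eq {a b r θ : ℝ} (h : S a b (r ^ 2) (cos θ ^ 2) ≠ 0) :
    sig11 a b r θ = n11 a b (r ^ 2) (cos θ ^ 2) / S a b (r ^ 2) (cos θ ^ 2) := by
  unfold sig11 n11 Afun
  rw [Sig_eq, show sin θ ^ 4 = (sin θ ^ 2) ^ 2 by ring, sin_sq]
  field_simp

lemma sig22_eq {a b r θ : ℝ} (h : S a b (r ^ 2) (cos θ ^ 2) ≠ 0) :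
    sig22 a b r θ = n22 a b (r ^ 2) (cos θ ^ 2) / S a b (r ^ 2) (cos θ ^ 2) := by
  unfold sig22 n22 Bfun
  rw [Sig_eq]
  field_simp

lemma sig12_eq {a b r θ : ℝ} :
    sig12 a b r θ = n12 a b (r ^ 2) (cos θ ^ 2) / S a b (r ^ 2) (cos θ ^ 2) := by
  unfold sig12 n12
  rw [Sig_eq, sin_sq]

lemma rho_sq (r θ : ℝ) : rho r θ ^ 2 = (r ^ 2) ^ 2 * (cos θ ^ 2 * (1 - cos θ ^ 2)) := by
  unfold rho; rw [← sin_sq]; ring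

lemma Phi_sq {a b r θ : ℝ} (ha : 0 < a) (hb : 0 < b) (hr : 0 < r)
    (hθ : θ ∈ Set.Ioo 0 (π / 2)) :
    Phi0 a b r θ ^ 2 = √(Q a b (r ^ 2) (cos θ ^ 2) * S a b (r ^ 2) (cos θ ^ 2))
      / (S a b (r ^ 2) (cos θ ^ 2) * r ^ 2) := by
  obtain ⟨hs, hc, hx, hx1⟩ := trig_dom hθ
  have hS := S_pos ha hb (pow_pos hr 2) hx hx1
  have hQ := Q_pos ha hb (pow_pos hr 2) hx hx1
  have hrho : 0 < rho r θ := by unfold rho; positivity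
  unfold Phi0
  rw [sq_sqrt (by positivity)]
  have hd : detSig a b r θ = (sin θ * cos θ / S a b (r ^ 2) (cos θ ^ 2)) ^ 2 *
      (Q a b (r ^ 2) (cos θ ^ 2) * S a b (r ^ 2) (cos θ ^ 2)) := by
    unfold detSig
    rw [sig11_eq hS.ne', sig22_eq hS.ne', sig12_eq]
    have := n_det a b (r ^ 2) (cos θ ^ 2)
    rw [div_mul_div_comm, div_pow, ← pow_two, ← sub_div, this, div_pow, mul_pow, sin_sq]
    ring
  rw [hd, sqrt_mul (by positivity), sqrt_sq (by positivity)]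
  unfold rho
  field_simp

lemma sigp_eq {a b r θ : ℝ} (ha : 0 < a) (hb : 0 < b) (hr : 0 < r)
    (hθ : θ ∈ Set.Ioo 0 (π / 2)) (n : ℝ) :
    n / S a b (r ^ 2) (cos θ ^ 2) / Phi0 a b r θ ^ 2
      = n * r ^ 2 / √(Q a b (r ^ 2) (cos θ ^ 2) * S a b (r ^ 2) (cos θ ^ 2)) := by
  obtain ⟨hs, hc, hx, hx1⟩ := trig_dom hθ
  have hS := S_pos ha hb (pow_pos hr 2) hx hx1
  have hQ := Q_pos ha hb (pow_pos hr 2) hx hx1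
  have hw : 0 < √(Q a b (r ^ 2) (cos θ ^ 2) * S a b (r ^ 2) (cos θ ^ 2)) := by positivity
  rw [Phi_sq ha hb hr hθ]
  field_simp

/-- Generic representation of `n r² / √(QΣ)`. -/
lemma rep_sig {a b r θ : ℝ} (ha : 0 < a) (hb : 0 < b) (hr : 0 < r)
    (hθ : θ ∈ Set.Ioo 0 (π / 2)) {f n : ℝ → ℝ → ℝ} {np nx : ℝ}
    (hf : ∀ s t : ℝ, 0 < s → t ∈ Set.Ioo 0 (π / 2) → f s t =
      n (s ^ 2) (cos t ^ 2) / S a b (s ^ 2) (cos t ^ 2) / Phi0 a b s t ^ 2)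
    (hnp : HasDerivAt (fun p => n p (cos θ ^ 2)) np (r ^ 2))
    (hnx : HasDerivAt (fun x => n (r ^ 2) x) nx (cos θ ^ 2)) {p x W Wp Wx : ℝ}
    (hp : p = r ^ 2) (hx : x = cos θ ^ 2)
    (hW : W = Q a b p x * S a b p x)
    (hWp : Wp = Qp a b p x * S a b p x + Q a b p x)
    (hWx : Wx = (a ^ 2 - b ^ 2) * p ^ 2 * S a b p x + Q a b p x * (a ^ 2 - b ^ 2)) :
    Rep f (fun p x => n p x * p / √(Q a b p x * S a b p x))
      ((2 * (np * p + n p x) * W - n p x * p * Wp) / (2 * W * √W))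
      ((2 * (nx * p) * W - n p x * p * Wx) / (2 * W * √W)) r θ := by
  obtain ⟨hs, hc, hx0, hx1⟩ := trig_dom hθ
  subst hp hx hW hWp hWx
  have hS := S_pos ha hb (pow_pos hr 2) hx0 hx1
  have hQ := Q_pos ha hb (pow_pos hr 2) hx0 hx1
  refine ⟨fun s t hs ht => ?_, ?_, ?_⟩
  · rw [hf s t hs ht, sigp_eq ha hb hs ht]
  · have h1 := (hnp.mul (hasDerivAt_id (r ^ 2)))
    have h2 := ((dQ_p a b (r ^ 2) (cos θ ^ 2)).mul (dS_p a b (r ^ 2) (cos θ ^ 2)))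
    have h3 := d_div_sqrt h1 h2 (mul_pos hQ hS)
    refine h3.congr_deriv ?_
    simp
  · have h1 := (hnx.mul_const (r ^ 2))
    have h2 := ((dQ_x a b (r ^ 2) (cos θ ^ 2)).mul (dS_x a b (r ^ 2) (cos θ ^ 2)))
    exact d_div_sqrt h1 h2 (mul_pos hQ hS)

lemma U_eq {a b r θ : ℝ} (ha : 0 < a) (hb : 0 < b) (hr : 0 < r)
    (hθ : θ ∈ Set.Ioo 0 (π / 2)) :
    Ufun a b r θ = 3 / 4 * log (S a b (r ^ 2) (cos θ ^ 2))
      - 1 / 4 * log (Q a b (r ^ 2) (cos θ ^ 2)) - 1 / 2 * log (r ^ 2) := by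
  obtain ⟨hs, hc, hx, hx1⟩ := trig_dom hθ
  have hS := S_pos ha hb (pow_pos hr 2) hx hx1
  have hQ := Q_pos ha hb (pow_pos hr 2) hx hx1
  have hw : 0 < √(Q a b (r ^ 2) (cos θ ^ 2) * S a b (r ^ 2) (cos θ ^ 2)) := by positivity
  unfold Ufun
  rw [Phi_sq ha hb hr hθ, Sig_eq]
  rw [show S a b (r ^ 2) (cos θ ^ 2) / (r ^ 4 *
    (√(Q a b (r ^ 2) (cos θ ^ 2) * S a b (r ^ 2) (cos θ ^ 2))
      / (S a b (r ^ 2) (cos θ ^ 2) * r ^ 2)))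
    = S a b (r ^ 2) (cos θ ^ 2) ^ 2 / (r ^ 2 *
      √(Q a b (r ^ 2) (cos θ ^ 2) * S a b (r ^ 2) (cos θ ^ 2))) by field_simp]
  rw [log_div (by positivity) (by positivity), log_mul (by positivity) hw.ne',
    log_sqrt (by positivity), log_mul hQ.ne' hS.ne', log_pow]
  push_cast
  ring

lemma Delta2_U {a b r θ p x : ℝ} (ha : 0 < a) (hb : 0 < b) (hr : 0 < r)
    (hθ : θ ∈ Set.Ioo 0 (π / 2)) (hp : p = r ^ 2) (hx : x = cos θ ^ 2) :
    -2 * Delta2 (Ufun a b) r θ = 1 / (2 * p ^ 2) *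
      (-3 * LS a b p x / S a b p x ^ 2 + LQ a b p x / Q a b p x ^ 2) := by
  obtain ⟨hs, hc, hx0, hx1⟩ := trig_dom hθ
  have hp0 : 0 < r ^ 2 := pow_pos hr 2
  have hS := S_pos ha hb hp0 hx0 hx1
  have hQ := Q_pos ha hb hp0 hx0 hx1
  rw [Delta2_chain (G := fun p x => 3 / 4 * log (S a b p x) - 1 / 4 * log (Q a b p x)
        - 1 / 2 * log p)
      (Gp := fun p x => 3 / 4 * (1 / S a b p x) - 1 / 4 * (Qp a b p x / Q a b p x)
        - 1 / 2 * p⁻¹)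
      (Gx := fun p x => 3 / 4 * ((a ^ 2 - b ^ 2) / S a b p x)
        - 1 / 4 * ((a ^ 2 - b ^ 2) * p ^ 2 / Q a b p x))
      hr hθ (fun s t hs ht => U_eq ha hb hs ht)
      (fun p x hp hx hx1 => (((dS_p a b p x).log (S_pos ha hb hp hx hx1).ne').const_mul
          (3 / 4) |>.sub (((dQ_p a b p x).log (Q_pos ha hb hp hx hx1).ne').const_mul
          (1 / 4))).sub ((hasDerivAt_log hp.ne').const_mul (1 / 2)))
      (fun p x hp hx hx1 => ((((dS_x a b p x).log (S_pos ha hb hp hx hx1).ne').const_mul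
          (3 / 4)).sub (((dQ_x a b p x).log (Q_pos ha hb hp hx hx1).ne').const_mul
          (1 / 4))).sub_const _)
      ((((hasDerivAt_const _ (1 : ℝ)).div (dS_p a b _ _) hS.ne').const_mul (3 / 4) |>.sub
        (((dQp_p a b _ _).div (dQ_p a b _ _) hQ.ne').const_mul (1 / 4))).sub
        ((hasDerivAt_inv hp0.ne').const_mul (1 / 2)))
      (((hasDerivAt_const _ (a ^ 2 - b ^ 2)).div (dS_x a b _ _) hS.ne').const_mul (3 / 4) |>.sub
        (((hasDerivAt_const _ ((a ^ 2 - b ^ 2) * (r ^ 2) ^ 2)).div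
          (dQ_x a b _ _) hQ.ne').const_mul (1 / 4)))]
  rw [← hp, ← hx] at *
  unfold LS LQ
  field_simp
  ring

lemma det_alg (p x W w u1 u2 v1 v2 z1 z2 k1 k2 Br : ℝ) (hp : p ≠ 0) (hx : x * (1 - x) ≠ 0)
    (hw : w ^ 2 = W) (hW : W ≠ 0)
    (h : p ^ 2 * (u1 * v1 - z1 ^ 2) + x * (1 - x) * (u2 * v2 - z2 ^ 2)
      = W * (p ^ 2 * x * (1 - x) * Br)) (hk : k1 = z1 ∧ k2 = z2) :
    (4 / p ^ 2 * (p ^ 2 * (u1 / (2 * W * w) * (v1 / (2 * W * w)))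
        + x * (1 - x) * (u2 / (2 * W * w) * (v2 / (2 * W * w))))
      - 4 / p ^ 2 * (p ^ 2 * (z1 / (2 * W * w) * (k1 / (2 * W * w)))
        + x * (1 - x) * (z2 / (2 * W * w) * (k2 / (2 * W * w)))))
      / (2 * (p ^ 2 * (x * (1 - x)))) = Br / (2 * p ^ 2 * W ^ 2) := by
  obtain ⟨rfl, rfl⟩ := hk
  have hw0 : w ≠ 0 := by rintro rfl; apply hW; rw [← hw]; ring
  have e : (4 / p ^ 2 * (p ^ 2 * (u1 / (2 * W * w) * (v1 / (2 * W * w)))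
        + x * (1 - x) * (u2 / (2 * W * w) * (v2 / (2 * W * w))))
      - 4 / p ^ 2 * (p ^ 2 * (k1 / (2 * W * w) * (k1 / (2 * W * w)))
        + x * (1 - x) * (k2 / (2 * W * w) * (k2 / (2 * W * w)))))
      = (p ^ 2 * (u1 * v1 - k1 ^ 2) + x * (1 - x) * (u2 * v2 - k2 ^ 2))
        / (p ^ 2 * W ^ 2 * w ^ 2) := by
    field_simp
    ring
  rw [e, h, hw]
  have hx' : 1 - x ≠ 0 := right_ne_zero_of_mul hx
  have hx'' : x ≠ 0 := left_ne_zero_of_mul hx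
  field_simp

/-- `det(2M'W - M W')` when `det M = g W`. -/
lemma det_expand (W W' g g' m1 m2 m3 d1 d2 d3 : ℝ) (h : m1 * m2 - m3 ^ 2 = g * W)
    (h' : d1 * m2 + m1 * d2 - 2 * m3 * d3 = g' * W + g * W') :
    (2 * d1 * W - m1 * W') * (2 * d2 * W - m2 * W') - (2 * d3 * W - m3 * W') ^ 2
      = W * (4 * W * (d1 * d2 - d3 ^ 2) - 2 * W * W' * g' - g * W' ^ 2) := by
  linear_combination W' ^ 2 * h - 2 * W * W' * h'

set_option maxHeartbeats 1000000 in
lemma Rt0_eq {a b r θ p x : ℝ} (ha : 0 < a) (hb : 0 < b) (hr : 0 < r)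
    (hθ : θ ∈ Set.Ioo 0 (π / 2)) (hp : p = r ^ 2) (hx : x = cos θ ^ 2) :
    Rt0 a b r θ = (-3 * LS a b p x * Q a b p x ^ 2 + LQ a b p x * S a b p x ^ 2 + br a b p x)
      / (2 * p * (Q a b p x * S a b p x) ^ 2) := by
  obtain ⟨hs, hc, hx0, hx1⟩ := trig_dom hθ
  have hp0 : 0 < r ^ 2 := pow_pos hr 2
  have hS := S_pos ha hb hp0 hx0 hx1
  have hQ := Q_pos ha hb hp0 hx0 hx1
  have R11 : Rep (sig11' a b) _ _ _ r θ := rep_sig ha hb hr hθ (n := n11 a b)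
    (fun s t hs ht => by
      unfold sig11'
      rw [sig11_eq (S_pos ha hb (pow_pos hs 2) (trig_dom ht).2.2.1 (trig_dom ht).2.2.2).ne'])
    (dn11_p a b _ _) (dn11_x a b _ _) hp hx rfl rfl rfl
  have R22 : Rep (sig22' a b) _ _ _ r θ := rep_sig ha hb hr hθ (n := n22 a b)
    (fun s t hs ht => by
      unfold sig22'
      rw [sig22_eq (S_pos ha hb (pow_pos hs 2) (trig_dom ht).2.2.1 (trig_dom ht).2.2.2).ne'])
    (dn22_p a b _ _) (dn22_x a b _ _) hp hx rfl rfl rfl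
  have R12 : Rep (sig12' a b) _ _ _ r θ := rep_sig ha hb hr hθ (n := n12 a b)
    (fun s t hs ht => by
      unfold sig12'
      rw [sig12_eq])
    (dn12_p a b _ _) (dn12_x a b _ _) hp hx rfl rfl rfl
  unfold Rt0
  rw [Delta2_U ha hb hr hθ hp hx, dInner_chain hr hθ R11 R22, dInner_chain hr hθ R12 R12, rho_sq]
  rw [← hp, ← hx] at *
  have hW := mul_pos hQ hS
  rw [det_alg p x (Q a b p x * S a b p x) _ _ _ _ _ _ _ _ _ (br a b p x) hp0.ne'
    (mul_pos hx0 (by linarith)).ne' (sq_sqrt hW.le) hW.ne' ?_ ⟨rfl, rfl⟩]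
  · field_simp
  · rw [det_expand (g := p ^ 2 * x * (1 - x)) (g' := 2 * p * x * (1 - x)),
      det_expand (g := p ^ 2 * x * (1 - x)) (g' := p ^ 2 * (1 - 2 * x))]
    · have := br_id a b p x
      rw [← this]
      ring
    · have := n_det a b p x
      linear_combination p ^ 2 * this
    · unfold n11x n22x n12x n11 n22 n12 Q S; ring
    · have := n_det a b p x
      linear_combination p ^ 2 * this
    · unfold n11p n22p n11 n22 n12 Qp Q S; ring

lemma K_alg (p x Sg q w k11 k22 k12 u1 u2 v1 v2 K : ℝ) (hp : p ≠ 0) (hx : x ≠ 0)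
    (hx1 : 1 - x ≠ 0) (hS : Sg ≠ 0) (hq : q ≠ 0) (hw : w ^ 2 = q * Sg)
    (h : k11 * (p ^ 2 * v1 ^ 2 + x * (1 - x) * v2 ^ 2)
      + k22 * (p ^ 2 * u1 ^ 2 + x * (1 - x) * u2 ^ 2)
      - 2 * k12 * (p ^ 2 * (u1 * v1) + x * (1 - x) * (u2 * v2))
      = x ^ 2 * (1 - x) ^ 2 * Sg * K) :
    p / (2 * (p ^ 2 * (x * (1 - x))) ^ 2) *
      (k11 * p / w * (4 / p ^ 2 * (p ^ 2 * (v1 / Sg ^ 2 * (v1 / Sg ^ 2))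
          + x * (1 - x) * (v2 / Sg ^ 2 * (v2 / Sg ^ 2))))
        + k22 * p / w * (4 / p ^ 2 * (p ^ 2 * (u1 / Sg ^ 2 * (u1 / Sg ^ 2))
          + x * (1 - x) * (u2 / Sg ^ 2 * (u2 / Sg ^ 2))))
        - 2 * (k12 * p / w) * (4 / p ^ 2 * (p ^ 2 * (u1 / Sg ^ 2 * (v1 / Sg ^ 2))
          + x * (1 - x) * (u2 / Sg ^ 2 * (v2 / Sg ^ 2)))))
      / (w / (Sg * p)) ^ 3 = 2 * K / (p * (q * Sg) ^ 2) := by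
  have hw0 : w ≠ 0 := by rintro rfl; apply mul_ne_zero hq hS; rw [← hw]; ring
  have e : (k11 * p / w * (4 / p ^ 2 * (p ^ 2 * (v1 / Sg ^ 2 * (v1 / Sg ^ 2))
          + x * (1 - x) * (v2 / Sg ^ 2 * (v2 / Sg ^ 2))))
        + k22 * p / w * (4 / p ^ 2 * (p ^ 2 * (u1 / Sg ^ 2 * (u1 / Sg ^ 2))
          + x * (1 - x) * (u2 / Sg ^ 2 * (u2 / Sg ^ 2))))
        - 2 * (k12 * p / w) * (4 / p ^ 2 * (p ^ 2 * (u1 / Sg ^ 2 * (v1 / Sg ^ 2))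
          + x * (1 - x) * (u2 / Sg ^ 2 * (v2 / Sg ^ 2)))))
      = 4 / (p * w * Sg ^ 4) * (k11 * (p ^ 2 * v1 ^ 2 + x * (1 - x) * v2 ^ 2)
      + k22 * (p ^ 2 * u1 ^ 2 + x * (1 - x) * u2 ^ 2)
      - 2 * k12 * (p ^ 2 * (u1 * v1) + x * (1 - x) * (u2 * v2))) := by
    field_simp
  rw [e, h, ← hw]
  field_simp
  ring

set_option maxHeartbeats 1000000 in
lemma Ksq_eq {a b r θ p x : ℝ} (ha : 0 < a) (hb : 0 < b) (hab : a ≠ b) (hr : 0 < r)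
    (hθ : θ ∈ Set.Ioo 0 (π / 2)) (hp : p = r ^ 2) (hx : x = cos θ ^ 2) :
    Ksq a b r θ / Phi0 a b r θ ^ 6 = 2 * Kn a b p x / (p * (Q a b p x * S a b p x) ^ 2) := by
  obtain ⟨hs, hc, hx0, hx1⟩ := trig_dom hθ
  have hp0 : 0 < r ^ 2 := pow_pos hr 2
  have hS := S_pos ha hb hp0 hx0 hx1
  have hQ := Q_pos ha hb hp0 hx0 hx1
  obtain ⟨d1, d2, d3, d4⟩ := dsome a b (r ^ 2) (cos θ ^ 2) (sub_ne_zero.2 hab) hS.ne'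
  have RP : Rep (omegaPhi a b) (omP a b) _ _ r θ := ⟨fun s t _ _ => by
    unfold omegaPhi omP Afun Bfun; rw [Sig_eq], d1, d2⟩
  have RQ : Rep (omegaPsi a b) (omQ a b) _ _ r θ := ⟨fun s t _ _ => by
    unfold omegaPsi omQ Afun Bfun; rw [Sig_eq], d3, d4⟩
  unfold Ksq sig11' sig22' sig12'
  rw [dInner_chain hr hθ RP RP, dInner_chain hr hθ RP RQ, dInner_chain hr hθ RQ RQ,
    sig11_eq hS.ne', sig22_eq hS.ne', sig12_eq, sigp_eq ha hb hr hθ, sigp_eq ha hb hr hθ,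
    sigp_eq ha hb hr hθ, show Phi0 a b r θ ^ 6 = (Phi0 a b r θ ^ 2) ^ 3 by ring,
    Phi_sq ha hb hr hθ, show rho r θ ^ 4 = (rho r θ ^ 2) ^ 2 by ring, rho_sq]
  rw [← hp, ← hx] at *
  exact K_alg p x (S a b p x) (Q a b p x) _ _ _ _ _ _ _ _ _ hp0.ne' hx0.ne'
    (by linarith : 0 < 1 - x).ne' hS.ne' hQ.ne' (sq_sqrt (mul_pos hQ hS).le) (K_id a b p x)

lemma alpha_eq {a b r θ p x : ℝ} (ha : 0 < a) (hb : 0 < b) (hab : a ≠ b) (hr : 0 < r)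
    (hθ : θ ∈ Set.Ioo 0 (π / 2)) (hp : p = r ^ 2) (hx : x = cos θ ^ 2) :
    Rt0 a b r θ / 6 + 5 * Ksq a b r θ / (6 * Phi0 a b r θ ^ 6)
      = (a + b) ^ 4 * N a b p x (1 - x) / (12 * p * (Q a b p x * S a b p x) ^ 2) := by
  rw [show 5 * Ksq a b r θ / (6 * Phi0 a b r θ ^ 6)
    = 5 / 6 * (Ksq a b r θ / Phi0 a b r θ ^ 6) by rw [div_mul_div_comm],
    Ksq_eq ha hb hab hr hθ hp hx, Rt0_eq ha hb hr hθ hp hx, ← N_id]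
  ring

/-! Sign and size of the numerator -/

set_option maxHeartbeats 2000000 in
lemma n_bounds {a b x y : ℝ} (ha : 0 < a) (hb : 0 < b) (hx : 0 < x) (hy : 0 < y)
    (hx1 : x ≤ 1) (hy1 : y ≤ 1) :
    (0 ≤ n0 a b x y ∧ n0 a b x y ≤ n0 a b 1 1) ∧ (0 ≤ n1 a b x y ∧ n1 a b x y ≤ n1 a b 1 1) ∧
    (0 ≤ n2 a b x y ∧ n2 a b x y ≤ n2 a b 1 1) ∧ (0 ≤ n3 a b x y ∧ n3 a b x y ≤ n3 a b 1 1) ∧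
    (0 ≤ n4 a b x y ∧ n4 a b x y ≤ n4 a b 1 1) ∧ (0 ≤ n5 a b x y ∧ n5 a b x y ≤ n5 a b 1 1) ∧
    (0 ≤ n6 a b x y ∧ n6 a b x y ≤ n6 a b 1 1) := by
  refine ⟨⟨?_, ?_⟩, ⟨?_, ?_⟩, ⟨?_, ?_⟩, ⟨?_, ?_⟩, ⟨?_, ?_⟩, ⟨?_, ?_⟩, ⟨?_, ?_⟩⟩
  · unfold n0; positivity
  · unfold n0; gcongr
  · unfold n1; positivity
  · unfold n1; gcongr
  · unfold n2; positivity
  · unfold n2; gcongr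
  · unfold n3; positivity
  · unfold n3; gcongr
  · unfold n4; positivity
  · unfold n4; gcongr
  · unfold n5; positivity
  · unfold n5; gcongr
  · unfold n6; positivity
  · unfold n6; gcongr

lemma N_nonneg {a b p x y : ℝ} (ha : 0 < a) (hb : 0 < b) (hx : 0 < x) (hy : 0 < y)
    (hx1 : x ≤ 1) (hy1 : y ≤ 1) (hp : 0 < p) : 0 ≤ N a b p x y := by
  obtain ⟨⟨h0, _⟩, ⟨h1, _⟩, ⟨h2, _⟩, ⟨h3, _⟩, ⟨h4, _⟩, ⟨h5, _⟩, ⟨h6, _⟩⟩ :=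
    n_bounds ha hb hx hy hx1 hy1
  unfold N; positivity

/-- `N / (p+e)^6` is bounded. -/
lemma N_le {a b p x y e T : ℝ} (ha : 0 < a) (hb : 0 < b) (hx : 0 < x) (hy : 0 < y)
    (hx1 : x ≤ 1) (hy1 : y ≤ 1) (hp : 0 < p) (he : 0 < e) (hT : 1 ≤ T) (hpT : p ≤ e * T) :
    N a b p x y ≤ N a b e 1 1 * T ^ 6 := by
  obtain ⟨⟨g0, h0⟩, ⟨g1, h1⟩, ⟨g2, h2⟩, ⟨g3, h3⟩, ⟨g4, h4⟩, ⟨g5, h5⟩, ⟨g6, h6⟩⟩ :=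
    n_bounds ha hb hx hy hx1 hy1
  have key : ∀ (c d : ℝ) (i : ℕ), i ≤ 6 → 0 ≤ c → c ≤ d → c * p ^ i ≤ d * (e ^ i * T ^ 6) := by
    intro c d i hi hc hcd
    have h1 : p ^ i ≤ (e * T) ^ i := pow_le_pow_left₀ hp.le hpT i
    have h2 : T ^ i ≤ T ^ 6 := pow_le_pow_right₀ hT hi
    have h3 : p ^ i ≤ e ^ i * T ^ 6 := by
      rw [mul_pow] at h1
      exact h1.trans (mul_le_mul_of_nonneg_left h2 (by positivity))
    exact mul_le_mul hcd h3 (by positivity) (hc.trans hcd)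
  have k0 := key _ _ 0 (by norm_num) g0 h0
  have k1 := key _ _ 1 (by norm_num) g1 h1
  have k2 := key _ _ 2 (by norm_num) g2 h2
  have k3 := key _ _ 3 (by norm_num) g3 h3
  have k4 := key _ _ 4 (by norm_num) g4 h4
  have k5 := key _ _ 5 (by norm_num) g5 h5
  have k6 := key _ _ 6 (by norm_num) g6 h6
  unfold N
  linarith

lemma QS_ge {a b p x : ℝ} (ha : 0 < a) (hb : 0 < b) (hp : 0 < p) (hx : 0 < x) (hx1 : x < 1) :
    p * (p + a * b) ^ 3 ≤ Q a b p x * S a b p x := by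
  have hy : 0 < 1 - x := by linarith
  have hab : 0 < a * b := mul_pos ha hb
  have hS : p + a * b ≤ S a b p x := by
    unfold S
    have : 0 < a ^ 2 * x + b ^ 2 * (1 - x) := by positivity
    linarith
  have hQ : p * (p + a * b) ^ 2 ≤ Q a b p x := by
    have e1 : p ^ 2 * (p + a * b) ≤ p ^ 2 * S a b p x := by gcongr
    have e2 : a * b * ((p + a * b) * (p + a * b)) ≤
        (a + b) ^ 2 * ((p + a * b + a ^ 2) * (p + a * b + b ^ 2)) := by
      have f1 : p + a * b ≤ p + a * b + a ^ 2 := by linarith [sq_nonneg a]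
      have f2 : p + a * b ≤ p + a * b + b ^ 2 := by linarith [sq_nonneg b]
      have f3 : a * b ≤ (a + b) ^ 2 := by nlinarith [sq_nonneg a, sq_nonneg b]
      have f4 : 0 < p + a * b := by positivity
      exact mul_le_mul f3 (mul_le_mul f1 f2 f4.le (f4.le.trans f1)) (by positivity)
        (by positivity)
    have e3 : 0 ≤ (a * b) * (a * b) * (p + a * b) := by positivity
    unfold Q
    nlinarith
  calc p * (p + a * b) ^ 3 = p * (p + a * b) ^ 2 * (p + a * b) := by ring
    _ ≤ Q a b p x * S a b p x := mul_le_mul hQ hS (by positivity) (le_trans (by positivity) hQ)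

end MPX

open MP in
/-- The coefficient `α = R̃₀/6 + 5K̃₀²/(6Φ₀⁶)` of the linearized Lichnerowicz operator
at the extreme Myers–Perry data (`a ≠ b`) is nonnegative and bounded by `C r⁻⁶`:
`0 ≤ α ≤ C r⁻⁶`, i.e. `α = h r⁻⁶` with `h` bounded and nonnegative. -/
theorem alpha_nonneg_bounded (a b : ℝ) (ha : 0 < a) (hb : 0 < b) (hab : a ≠ b) :
    (∀ r θ : ℝ, 0 < r → θ ∈ Set.Ioo 0 (Real.pi / 2) →
        0 ≤ Rt0 a b r θ / 6 + 5 * Ksq a b r θ / (6 * Phi0 a b r θ ^ 6)) ∧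
    ∃ C : ℝ, 0 < C ∧
      ∀ r θ : ℝ, 0 < r → θ ∈ Set.Ioo 0 (Real.pi / 2) →
        Rt0 a b r θ / 6 + 5 * Ksq a b r θ / (6 * Phi0 a b r θ ^ 6) ≤ C / r ^ 6 := by
  have hab0 : 0 < a * b := mul_pos ha hb
  refine ⟨?_, (a + b) ^ 4 * MPX.N a b (a * b) 1 1 / (12 * (a * b) ^ 6) + 1, ?_, ?_⟩
  · intro r θ hr hθ
    rw [MPX.alpha_eq ha hb hab hr hθ rfl rfl]
    obtain ⟨hs, hc, hx0, hx1⟩ := MPX.trig_dom hθ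
    have := MPX.N_nonneg (p := r ^ 2) ha hb hx0 (sub_pos.2 hx1) hx1.le (by linarith)
      (pow_pos hr 2)
    positivity
  · have := MPX.N_nonneg (p := a * b) ha hb one_pos one_pos le_rfl le_rfl hab0
    positivity
  · intro r θ hr hθ
    rw [MPX.alpha_eq ha hb hab hr hθ rfl rfl]
    obtain ⟨hs, hc, hx0, hx1⟩ := MPX.trig_dom hθ
    have hp : 0 < r ^ 2 := pow_pos hr 2
    have hN1 := MPX.N_nonneg (p := a * b) ha hb one_pos one_pos le_rfl le_rfl hab0
    have hT : 1 ≤ (r ^ 2 + a * b) / (a * b) := by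
      rw [le_div_iff₀ hab0]; linarith
    have hpT : r ^ 2 ≤ a * b * ((r ^ 2 + a * b) / (a * b)) := by
      rw [mul_div_cancel₀ _ hab0.ne']; linarith
    have hN := MPX.N_le (y := 1 - Real.cos θ ^ 2) ha hb hx0 (sub_pos.2 hx1) hx1.le
      (by linarith) hp hab0 hT hpT
    have hW := MPX.QS_ge ha hb hp hx0 hx1
    have hW2 := pow_le_pow_left₀ (by positivity) hW 2
    have hd : 0 < (r ^ 2 * (r ^ 2 + a * b) ^ 3) ^ 2 := by positivity
    calc (a + b) ^ 4 * MPX.N a b (r ^ 2) (Real.cos θ ^ 2) (1 - Real.cos θ ^ 2) /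
          (12 * r ^ 2 * (MPX.Q a b (r ^ 2) (Real.cos θ ^ 2) *
            MPX.S a b (r ^ 2) (Real.cos θ ^ 2)) ^ 2)
        ≤ (a + b) ^ 4 * (MPX.N a b (a * b) 1 1 * ((r ^ 2 + a * b) / (a * b)) ^ 6) /
          (12 * r ^ 2 * (r ^ 2 * (r ^ 2 + a * b) ^ 3) ^ 2) := by
          gcongr
      _ = (a + b) ^ 4 * MPX.N a b (a * b) 1 1 / (12 * (a * b) ^ 6) / r ^ 6 := by
          field_simp
      _ ≤ ((a + b) ^ 4 * MPX.N a b (a * b) 1 1 / (12 * (a * b) ^ 6) + 1) / r ^ 6 := by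
          gcongr
          linarith

end
end

section
/- With the notation of the extreme Myers–Perry conformal data and assuming additionally a ≠ b, the conformal factor Φ₀ satisfies the Lichnerowicz equation: for all r > 0 and θ ∈ (0, π/2), Δ₄Φ₀ − (R̃₀/6)·Φ₀ + K̃₀²/(6Φ₀⁵) = 0, where Δ₄ f = ∂²_r f + (3/r)∂_r f + r^{-2}( ∂²_θ f + (cot θ − tan θ)∂_θ f ). -/
noncomputable section

namespace MPaux

open MP

/-- Lift a function of `(q, x) = (r², cos²θ)` to a function of `(r, θ)`. -/
def lift (G : ℝ → ℝ → ℝ) (r θ : ℝ) : ℝ := G (r ^ 2) (Real.cos θ ^ 2)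

/-- Agreement on the open coordinate domain. -/
def EqDom (f g : ℝ → ℝ → ℝ) : Prop :=
  ∀ r θ : ℝ, 0 < r → θ ∈ Set.Ioo 0 (Real.pi / 2) → f r θ = g r θ

/-- `Gq` is the first partial derivative of `G`. -/
def Hq (G Gq : ℝ → ℝ → ℝ) : Prop :=
  ∀ q x : ℝ, 0 < q → 0 < x → x < 1 → HasDerivAt (fun s => G s x) (Gq q x) q

/-- `Gx` is the second partial derivative of `G`. -/
def Hx (G Gx : ℝ → ℝ → ℝ) : Prop :=
  ∀ q x : ℝ, 0 < q → 0 < x → x < 1 → HasDerivAt (fun t => G q t) (Gx q x) x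

lemma pdr_congr {f g : ℝ → ℝ → ℝ} (h : EqDom f g) : EqDom (pdr f) (pdr g) := by
  intro r θ hr hθ
  apply Filter.EventuallyEq.deriv_eq
  filter_upwards [lt_mem_nhds hr] with s hs using h s θ hs hθ

lemma pdt_congr {f g : ℝ → ℝ → ℝ} (h : EqDom f g) : EqDom (pdt f) (pdt g) := by
  intro r θ hr hθ
  apply Filter.EventuallyEq.deriv_eq
  filter_upwards [isOpen_Ioo.mem_nhds hθ] with s hs using h r s hr hs

lemma dom_facts {θ : ℝ} (hθ : θ ∈ Set.Ioo 0 (Real.pi / 2)) :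
    0 < Real.sin θ ∧ 0 < Real.cos θ ∧ 0 < Real.cos θ ^ 2 ∧ Real.cos θ ^ 2 < 1 := by
  have h1 : 0 < Real.sin θ := Real.sin_pos_of_pos_of_lt_pi hθ.1 (by linarith [hθ.2, Real.pi_pos])
  have h2 : 0 < Real.cos θ := Real.cos_pos_of_mem_Ioo ⟨by linarith [hθ.1, Real.pi_pos], hθ.2⟩
  have h3 := Real.sin_sq_add_cos_sq θ
  exact ⟨h1, h2, by positivity, by nlinarith⟩

lemma hasDeriv_r {G Gq : ℝ → ℝ → ℝ} (h : Hq G Gq) {r θ : ℝ} (hr : 0 < r)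
    (hθ : θ ∈ Set.Ioo 0 (Real.pi / 2)) :
    HasDerivAt (fun s => lift G s θ) (lift Gq r θ * (2 * r)) r := by
  obtain ⟨_, _, h3, h4⟩ := dom_facts hθ
  have h1 := h (r ^ 2) _ (by positivity) h3 h4
  have h2 : HasDerivAt (fun s : ℝ => s ^ 2) (2 * r) r := by
    simpa using hasDerivAt_pow 2 r
  exact HasDerivAt.comp (h₂ := fun s => G s (Real.cos θ ^ 2)) r h1 h2

lemma hasDeriv_t {G Gx : ℝ → ℝ → ℝ} (h : Hx G Gx) {r θ : ℝ} (hr : 0 < r)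
    (hθ : θ ∈ Set.Ioo 0 (Real.pi / 2)) :
    HasDerivAt (fun t => lift G r t) (lift Gx r θ * (-2 * (Real.sin θ * Real.cos θ))) θ := by
  obtain ⟨_, _, h3, h4⟩ := dom_facts hθ
  have h1 := h (r ^ 2) _ (by positivity) h3 h4
  have h2 : HasDerivAt (fun s : ℝ => Real.cos s ^ 2) (-2 * (Real.sin θ * Real.cos θ)) θ := by
    have := (Real.hasDerivAt_cos θ).fun_pow 2
    refine this.congr_deriv ?_
    push_cast; ring
  exact HasDerivAt.comp (h₂ := fun s => G (r ^ 2) s) θ h1 h2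

lemma pdr_lift {f G Gq : ℝ → ℝ → ℝ} (hf : EqDom f (lift G)) (h : Hq G Gq) :
    EqDom (pdr f) (fun r θ => lift Gq r θ * (2 * r)) := by
  intro r θ hr hθ
  rw [pdr_congr hf r θ hr hθ]
  exact (hasDeriv_r h hr hθ).deriv

lemma pdt_lift {f G Gx : ℝ → ℝ → ℝ} (hf : EqDom f (lift G)) (h : Hx G Gx) :
    EqDom (pdt f) (fun r θ => lift Gx r θ * (-2 * (Real.sin θ * Real.cos θ))) := by
  intro r θ hr hθ
  rw [pdt_congr hf r θ hr hθ]
  exact (hasDeriv_t h hr hθ).deriv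

lemma pdrr_lift {f G Gq Gqq : ℝ → ℝ → ℝ} (hf : EqDom f (lift G)) (h : Hq G Gq)
    (h2 : Hq Gq Gqq) :
    EqDom (pdr (pdr f)) (fun r θ => 4 * r ^ 2 * lift Gqq r θ + 2 * lift Gq r θ) := by
  intro r θ hr hθ
  rw [pdr_congr (pdr_lift hf h) r θ hr hθ]
  have h3 : HasDerivAt (fun s : ℝ => 2 * s) 2 r := by
    simpa using (hasDerivAt_id r).const_mul 2
  have := (hasDeriv_r h2 hr hθ).fun_mul h3
  unfold pdr
  rw [this.deriv]; ring

lemma pdtt_lift {f G Gx Gxx : ℝ → ℝ → ℝ} (hf : EqDom f (lift G)) (h : Hx G Gx)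
    (h2 : Hx Gx Gxx) :
    EqDom (pdt (pdt f)) (fun r θ => 4 * (Real.sin θ * Real.cos θ) ^ 2 * lift Gxx r θ
      - 2 * (Real.cos θ ^ 2 - Real.sin θ ^ 2) * lift Gx r θ) := by
  intro r θ hr hθ
  rw [pdt_congr (pdt_lift hf h) r θ hr hθ]
  have h3 := ((Real.hasDerivAt_sin θ).fun_mul (Real.hasDerivAt_cos θ)).const_mul (-2)
  have := (hasDeriv_t h2 hr hθ).fun_mul h3
  unfold pdt
  rw [this.deriv]; ring

lemma dInner_lift {f g G Gq Gx K Kq Kx : ℝ → ℝ → ℝ} (hf : EqDom f (lift G))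
    (hg : EqDom g (lift K)) (hGq : Hq G Gq) (hGx : Hx G Gx) (hKq : Hq K Kq) (hKx : Hx K Kx)
    {r θ q x : ℝ} (hr : 0 < r) (hθ : θ ∈ Set.Ioo 0 (Real.pi / 2))
    (hq : q = r ^ 2) (hx : x = Real.cos θ ^ 2) :
    dInner f g r θ = 4 * (q * Gq q x * Kq q x + x * (1 - x) * (Gx q x * Kx q x) / q) / q := by
  unfold dInner
  rw [pdr_lift hf hGq r θ hr hθ, pdr_lift hg hKq r θ hr hθ, pdt_lift hf hGx r θ hr hθ,
    pdt_lift hg hKx r θ hr hθ]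
  have hs : Real.sin θ ^ 2 = 1 - x := by rw [hx]; linarith [Real.sin_sq_add_cos_sq θ]
  simp only [lift, ← hq, ← hx]
  have e1 : Gq q x * (2 * r) * (Kq q x * (2 * r)) = 4 * (q * Gq q x * Kq q x) := by
    rw [hq]; ring
  have e2 : Gx q x * (-2 * (Real.sin θ * Real.cos θ)) * (Kx q x * (-2 * (Real.sin θ * Real.cos θ)))
      = 4 * (x * (1 - x) * (Gx q x * Kx q x)) := by
    rw [← hs]
    have : x * Real.sin θ ^ 2 = (Real.sin θ * Real.cos θ) ^ 2 := by rw [hx]; ring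
    rw [this]; ring
  rw [e1, e2]; ring

lemma Delta4_lift {f G Gq Gx Gqq Gxx : ℝ → ℝ → ℝ} (hf : EqDom f (lift G))
    (hGq : Hq G Gq) (hGx : Hx G Gx) (hGqq : Hq Gq Gqq) (hGxx : Hx Gx Gxx)
    {r θ q x : ℝ} (hr : 0 < r) (hθ : θ ∈ Set.Ioo 0 (Real.pi / 2))
    (hq : q = r ^ 2) (hx : x = Real.cos θ ^ 2) :
    Delta4 f r θ = 4 * q * Gqq q x + 8 * Gq q x +
      (4 * (x * (1 - x)) * Gxx q x - 4 * (2 * x - 1) * Gx q x) / q := by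
  obtain ⟨h1, h2, _, _⟩ := dom_facts hθ
  unfold Delta4
  rw [pdr_lift hf hGq r θ hr hθ, pdt_lift hf hGx r θ hr hθ, pdrr_lift hf hGq hGqq r θ hr hθ,
    pdtt_lift hf hGx hGxx r θ hr hθ]
  have hs : Real.sin θ ^ 2 = 1 - x := by rw [hx]; linarith [Real.sin_sq_add_cos_sq θ]
  simp only [lift, ← hq, ← hx]
  have e1 : 3 / r * (Gq q x * (2 * r)) = 6 * Gq q x := by field_simp; ring
  have e2 : (Real.cos θ / Real.sin θ - Real.sin θ / Real.cos θ) *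
      (Gx q x * (-2 * (Real.sin θ * Real.cos θ))) = -2 * (x - Real.sin θ ^ 2) * Gx q x := by
    rw [hx]; field_simp
  have e3 : (Real.sin θ * Real.cos θ) ^ 2 = x * (1 - x) := by rw [mul_pow, hs, ← hx]; ring
  rw [e1, e2, e3, hs]; ring

lemma Delta2_lift {f G Gq Gx Gqq Gxx : ℝ → ℝ → ℝ} (hf : EqDom f (lift G))
    (hGq : Hq G Gq) (hGx : Hx G Gx) (hGqq : Hq Gq Gqq) (hGxx : Hx Gx Gxx)
    {r θ q x : ℝ} (hr : 0 < r) (hθ : θ ∈ Set.Ioo 0 (Real.pi / 2))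
    (hq : q = r ^ 2) (hx : x = Real.cos θ ^ 2) :
    Delta2 f r θ = (4 * q ^ 2 * Gqq q x + 4 * q * Gq q x +
      4 * (x * (1 - x)) * Gxx q x - 2 * (2 * x - 1) * Gx q x) / q ^ 2 := by
  unfold Delta2
  rw [pdr_lift hf hGq r θ hr hθ, pdrr_lift hf hGq hGqq r θ hr hθ,
    pdtt_lift hf hGx hGxx r θ hr hθ]
  have hs : Real.sin θ ^ 2 = 1 - x := by rw [hx]; linarith [Real.sin_sq_add_cos_sq θ]
  simp only [lift, ← hq, ← hx]
  have e3 : (Real.sin θ * Real.cos θ) ^ 2 = x * (1 - x) := by rw [mul_pow, hs, ← hx]; ring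
  have e4 : r ^ 4 = q ^ 2 := by rw [hq]; ring
  have e5 : r * (Gq q x * (2 * r)) = 2 * q * Gq q x := by rw [hq]; ring
  rw [e3, hs, e4, e5]; ring

/-! Explicit functions of `(q, x)`. -/

def cA (a b q : ℝ) : ℝ := q + a * b + a ^ 2
def cB (a b q : ℝ) : ℝ := q + a * b + b ^ 2
def cS (a b q x : ℝ) : ℝ := q + a * b + b ^ 2 + (a ^ 2 - b ^ 2) * x
def cN (a b q x : ℝ) : ℝ := cA a b q * cB a b q * cS a b q x +
  (a + b) ^ 2 * (a ^ 2 * (1 - x) * cB a b q + b ^ 2 * x * cA a b q)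
def cNq (a b q x : ℝ) : ℝ := (cA a b q + cB a b q) * cS a b q x + cA a b q * cB a b q +
  (a + b) ^ 2 * (a ^ 2 * (1 - x) + b ^ 2 * x)
def cNqq (a b q x : ℝ) : ℝ := 2 * cS a b q x + 2 * (cA a b q + cB a b q)
def cNx (a b q : ℝ) : ℝ := (a ^ 2 - b ^ 2) * q ^ 2
def c11 (a b q x : ℝ) : ℝ := a ^ 2 * (a + b) ^ 2 * (1 - x) ^ 2 / cS a b q x + cA a b q * (1 - x)
def c11q (a b q x : ℝ) : ℝ := -(a ^ 2 * (a + b) ^ 2 * (1 - x) ^ 2) / cS a b q x ^ 2 + (1 - x)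
def c11x (a b q x : ℝ) : ℝ := -2 * a ^ 2 * (a + b) ^ 2 * (1 - x) / cS a b q x -
  a ^ 2 * (a + b) ^ 2 * (1 - x) ^ 2 * (a ^ 2 - b ^ 2) / cS a b q x ^ 2 - cA a b q
def c22 (a b q x : ℝ) : ℝ := b ^ 2 * (a + b) ^ 2 * x ^ 2 / cS a b q x + cB a b q * x
def c22q (a b q x : ℝ) : ℝ := -(b ^ 2 * (a + b) ^ 2 * x ^ 2) / cS a b q x ^ 2 + x
def c22x (a b q x : ℝ) : ℝ := 2 * b ^ 2 * (a + b) ^ 2 * x / cS a b q x -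
  b ^ 2 * (a + b) ^ 2 * x ^ 2 * (a ^ 2 - b ^ 2) / cS a b q x ^ 2 + cB a b q
def c12 (a b q x : ℝ) : ℝ := a * b * (a + b) ^ 2 * (x * (1 - x)) / cS a b q x
def c12q (a b q x : ℝ) : ℝ := -(a * b * (a + b) ^ 2 * (x * (1 - x))) / cS a b q x ^ 2
def c12x (a b q x : ℝ) : ℝ := a * b * (a + b) ^ 2 * (1 - 2 * x) / cS a b q x -
  a * b * (a + b) ^ 2 * (x * (1 - x)) * (a ^ 2 - b ^ 2) / cS a b q x ^ 2
def cF (a b q x : ℝ) : ℝ := (a * (a ^ 2 - b ^ 2) * cB a b q * x -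
      a * q * (2 * a ^ 2 + 2 * a * b + q)) / (a - b) ^ 2 +
    a * cA a b q ^ 2 * cB a b q / (cS a b q x * (a - b) ^ 2)
def cFq (a b q x : ℝ) : ℝ :=
  a * (a + b) ^ 2 * (a ^ 2 - b ^ 2) * x * (1 - x) ^ 2 / cS a b q x ^ 2
def cFx (a b q x : ℝ) : ℝ :=
  -(a * (a + b) ^ 2 * (1 - x) * cB a b q * (cS a b q x + cA a b q)) / cS a b q x ^ 2
def cP (a b q x : ℝ) : ℝ := (b * q * ((a + b) ^ 2 + q) -
      b * (a ^ 2 - b ^ 2) * cA a b q * x) / (a - b) ^ 2 -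
    b * cA a b q * cB a b q ^ 2 / (cS a b q x * (a - b) ^ 2)
def cPq (a b q x : ℝ) : ℝ :=
  b * (a + b) ^ 2 * (a ^ 2 - b ^ 2) * x ^ 2 * (1 - x) / cS a b q x ^ 2
def cPx (a b q x : ℝ) : ℝ :=
  -(b * (a + b) ^ 2 * x * cA a b q * (cS a b q x + cB a b q)) / cS a b q x ^ 2
def cL (a b q x : ℝ) : ℝ := Real.log (cN a b q x) - Real.log (cS a b q x) - 2 * Real.log q
def cLq (a b q x : ℝ) : ℝ := cNq a b q x / cN a b q x - 1 / cS a b q x - 2 / q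
def cLqq (a b q x : ℝ) : ℝ := cNqq a b q x / cN a b q x - cNq a b q x ^ 2 / cN a b q x ^ 2 +
  1 / cS a b q x ^ 2 + 2 / q ^ 2
def cLx (a b q x : ℝ) : ℝ := cNx a b q / cN a b q x - (a ^ 2 - b ^ 2) / cS a b q x
def cLxx (a b q x : ℝ) : ℝ := -cNx a b q ^ 2 / cN a b q x ^ 2 +
  (a ^ 2 - b ^ 2) ^ 2 / cS a b q x ^ 2
def cU (a b q x : ℝ) : ℝ := Real.log (cS a b q x) / 2 - Real.log q - cL a b q x / 4
def cUq (a b q x : ℝ) : ℝ := 1 / cS a b q x / 2 - 1 / q - cLq a b q x / 4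
def cUqq (a b q x : ℝ) : ℝ := -1 / cS a b q x ^ 2 / 2 + 1 / q ^ 2 - cLqq a b q x / 4
def cUx (a b q x : ℝ) : ℝ := (a ^ 2 - b ^ 2) / cS a b q x / 2 - cLx a b q x / 4
def cUxx (a b q x : ℝ) : ℝ := -(a ^ 2 - b ^ 2) ^ 2 / cS a b q x ^ 2 / 2 - cLxx a b q x / 4
def cE (a b q x : ℝ) : ℝ := Real.exp (cL a b q x / 4)
def cEq (a b q x : ℝ) : ℝ := cE a b q x * (cLq a b q x / 4)
def cEqq (a b q x : ℝ) : ℝ := cE a b q x * (cLqq a b q x / 4 + cLq a b q x ^ 2 / 16)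
def cEx (a b q x : ℝ) : ℝ := cE a b q x * (cLx a b q x / 4)
def cExx (a b q x : ℝ) : ℝ := cE a b q x * (cLxx a b q x / 4 + cLx a b q x ^ 2 / 16)

section
variable {a b : ℝ}

lemma cA_pos (ha : 0 < a) (hb : 0 < b) {q : ℝ} (hq : 0 < q) : 0 < cA a b q := by
  unfold cA; positivity

lemma cB_pos (ha : 0 < a) (hb : 0 < b) {q : ℝ} (hq : 0 < q) : 0 < cB a b q := by
  unfold cB; positivity

lemma cS_pos (ha : 0 < a) (hb : 0 < b) {q x : ℝ} (hq : 0 < q) (hx : 0 < x) (hx1 : x < 1) :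
    0 < cS a b q x := by
  have h : 0 < 1 - x := by linarith
  have : cS a b q x = q + a * b + b ^ 2 * (1 - x) + a ^ 2 * x := by unfold cS; ring
  rw [this]; positivity

lemma cN_pos (ha : 0 < a) (hb : 0 < b) {q x : ℝ} (hq : 0 < q) (hx : 0 < x) (hx1 : x < 1) :
    0 < cN a b q x := by
  have h : 0 < 1 - x := by linarith
  have h1 := cA_pos ha hb hq
  have h2 := cB_pos ha hb hq
  have h3 := cS_pos ha hb hq hx hx1
  unfold cN; positivity

lemma cA_d (a b : ℝ) (q : ℝ) : HasDerivAt (fun q => cA a b q) 1 q :=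
  ((hasDerivAt_id q).add_const _).add_const _

lemma cB_d (a b : ℝ) (q : ℝ) : HasDerivAt (fun q => cB a b q) 1 q :=
  ((hasDerivAt_id q).add_const _).add_const _

lemma cS_dq (a b : ℝ) (q x : ℝ) : HasDerivAt (fun q => cS a b q x) 1 q :=
  (((hasDerivAt_id q).add_const _).add_const _).add_const _

lemma cS_dx (a b : ℝ) (q x : ℝ) : HasDerivAt (fun x => cS a b q x) (a ^ 2 - b ^ 2) x := by
  have := ((hasDerivAt_id x).const_mul (a ^ 2 - b ^ 2)).const_add (q + a * b + b ^ 2)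
  simpa [cS] using this

lemma y_d (x : ℝ) : HasDerivAt (fun x : ℝ => 1 - x) (-1) x := by
  simpa using (hasDerivAt_id x).const_sub 1

lemma cN_dq (a b : ℝ) (q x : ℝ) : HasDerivAt (fun q => cN a b q x) (cNq a b q x) q := by
  have h := (((cA_d a b q).fun_mul (cB_d a b q)).fun_mul (cS_dq a b q x)).fun_add
    ((((cB_d a b q).const_mul (a ^ 2 * (1 - x))).fun_add
      ((cA_d a b q).const_mul (b ^ 2 * x))).const_mul ((a + b) ^ 2))
  refine h.congr_deriv ?_
  unfold cNq; ring

lemma cN_dx (a b : ℝ) (q x : ℝ) : HasDerivAt (fun x => cN a b q x) (cNx a b q) x := by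
  have h := ((cS_dx a b q x).const_mul (cA a b q * cB a b q)).fun_add
    (((((y_d x).const_mul (a ^ 2)).mul_const (cB a b q)).fun_add
      (((hasDerivAt_id' x).const_mul (b ^ 2)).mul_const (cA a b q))).const_mul ((a + b) ^ 2))
  refine h.congr_deriv ?_
  unfold cNx cA cB; ring

lemma cNq_dq (a b : ℝ) (q x : ℝ) : HasDerivAt (fun q => cNq a b q x) (cNqq a b q x) q := by
  have h := ((((cA_d a b q).fun_add (cB_d a b q)).fun_mul (cS_dq a b q x)).fun_add
    ((cA_d a b q).fun_mul (cB_d a b q))).add_const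
    ((a + b) ^ 2 * (a ^ 2 * (1 - x) + b ^ 2 * x))
  refine h.congr_deriv ?_
  unfold cNqq; ring

lemma cL_dq (ha : 0 < a) (hb : 0 < b) : Hq (cL a b) (cLq a b) := by
  intro q x hq hx hx1
  have hS := (cS_pos ha hb hq hx hx1).ne'
  have hN := (cN_pos ha hb hq hx hx1).ne'
  have h := (((cN_dq a b q x).log hN).fun_sub ((cS_dq a b q x).log hS)).fun_sub
    ((Real.hasDerivAt_log hq.ne').const_mul 2)
  refine h.congr_deriv ?_
  unfold cLq; ring

lemma cL_dx (ha : 0 < a) (hb : 0 < b) : Hx (cL a b) (cLx a b) := by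
  intro q x hq hx hx1
  have hS := (cS_pos ha hb hq hx hx1).ne'
  have hN := (cN_pos ha hb hq hx hx1).ne'
  exact (((cN_dx a b q x).log hN).fun_sub ((cS_dx a b q x).log hS)).sub_const _

lemma cLq_dq (ha : 0 < a) (hb : 0 < b) : Hq (cLq a b) (cLqq a b) := by
  intro q x hq hx hx1
  have hS := (cS_pos ha hb hq hx hx1).ne'
  have hN := (cN_pos ha hb hq hx hx1).ne'
  have h := (((cNq_dq a b q x).fun_div (cN_dq a b q x) hN).fun_sub
    ((hasDerivAt_const q (1 : ℝ)).fun_div (cS_dq a b q x) hS)).fun_sub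
    ((hasDerivAt_const q (2 : ℝ)).fun_div (hasDerivAt_id' q) hq.ne')
  refine h.congr_deriv ?_
  unfold cLqq; field_simp; ring

lemma cLx_dx (ha : 0 < a) (hb : 0 < b) : Hx (cLx a b) (cLxx a b) := by
  intro q x hq hx hx1
  have hS := (cS_pos ha hb hq hx hx1).ne'
  have hN := (cN_pos ha hb hq hx hx1).ne'
  have h := ((hasDerivAt_const x (cNx a b q)).fun_div (cN_dx a b q x) hN).fun_sub
    ((hasDerivAt_const x (a ^ 2 - b ^ 2)).fun_div (cS_dx a b q x) hS)
  refine h.congr_deriv ?_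
  unfold cLxx; field_simp; ring

lemma cU_dq (ha : 0 < a) (hb : 0 < b) : Hq (cU a b) (cUq a b) := by
  intro q x hq hx hx1
  have hS := (cS_pos ha hb hq hx hx1).ne'
  have h := ((((cS_dq a b q x).log hS).div_const 2).fun_sub (Real.hasDerivAt_log hq.ne')).fun_sub
    ((cL_dq ha hb q x hq hx hx1).div_const 4)
  refine h.congr_deriv ?_
  unfold cUq; ring

lemma cU_dx (ha : 0 < a) (hb : 0 < b) : Hx (cU a b) (cUx a b) := by
  intro q x hq hx hx1
  have hS := (cS_pos ha hb hq hx hx1).ne'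
  exact ((((cS_dx a b q x).log hS).div_const 2).sub_const _).fun_sub
    ((cL_dx ha hb q x hq hx hx1).div_const 4)

lemma cUq_dq (ha : 0 < a) (hb : 0 < b) : Hq (cUq a b) (cUqq a b) := by
  intro q x hq hx hx1
  have hS := (cS_pos ha hb hq hx hx1).ne'
  have h := ((((hasDerivAt_const q (1 : ℝ)).fun_div (cS_dq a b q x) hS).div_const 2).fun_sub
    ((hasDerivAt_const q (1 : ℝ)).fun_div (hasDerivAt_id' q) hq.ne')).fun_sub
    ((cLq_dq ha hb q x hq hx hx1).div_const 4)
  refine h.congr_deriv ?_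
  unfold cUqq; ring

lemma cUx_dx (ha : 0 < a) (hb : 0 < b) : Hx (cUx a b) (cUxx a b) := by
  intro q x hq hx hx1
  have hS := (cS_pos ha hb hq hx hx1).ne'
  have h := (((hasDerivAt_const x (a ^ 2 - b ^ 2)).fun_div (cS_dx a b q x) hS).div_const 2).fun_sub
    ((cLx_dx ha hb q x hq hx hx1).div_const 4)
  refine h.congr_deriv ?_
  unfold cUxx; ring

lemma cE_dq (ha : 0 < a) (hb : 0 < b) : Hq (cE a b) (cEq a b) := by
  intro q x hq hx hx1
  exact ((cL_dq ha hb q x hq hx hx1).div_const 4).exp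

lemma cE_dx (ha : 0 < a) (hb : 0 < b) : Hx (cE a b) (cEx a b) := by
  intro q x hq hx hx1
  exact ((cL_dx ha hb q x hq hx hx1).div_const 4).exp

lemma cEq_dq (ha : 0 < a) (hb : 0 < b) : Hq (cEq a b) (cEqq a b) := by
  intro q x hq hx hx1
  have h := (cE_dq ha hb q x hq hx hx1).fun_mul ((cLq_dq ha hb q x hq hx hx1).div_const 4)
  refine h.congr_deriv ?_
  unfold cEqq cEq; ring

lemma cEx_dx (ha : 0 < a) (hb : 0 < b) : Hx (cEx a b) (cExx a b) := by
  intro q x hq hx hx1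
  have h := (cE_dx ha hb q x hq hx hx1).fun_mul ((cLx_dx ha hb q x hq hx hx1).div_const 4)
  refine h.congr_deriv ?_
  unfold cExx cEx; ring

lemma c11_dq (ha : 0 < a) (hb : 0 < b) : Hq (c11 a b) (c11q a b) := by
  intro q x hq hx hx1
  have hS := (cS_pos ha hb hq hx hx1).ne'
  have h := ((hasDerivAt_const q (a ^ 2 * (a + b) ^ 2 * (1 - x) ^ 2)).fun_div
    (cS_dq a b q x) hS).fun_add ((cA_d a b q).mul_const (1 - x))
  refine h.congr_deriv ?_
  unfold c11q; ring

lemma c11_dx (ha : 0 < a) (hb : 0 < b) : Hx (c11 a b) (c11x a b) := by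
  intro q x hq hx hx1
  have hS := (cS_pos ha hb hq hx hx1).ne'
  have h := ((((y_d x).fun_pow 2).const_mul (a ^ 2 * (a + b) ^ 2)).fun_div
    (cS_dx a b q x) hS).fun_add ((y_d x).const_mul (cA a b q))
  refine h.congr_deriv ?_
  unfold c11x; push_cast; field_simp; ring

lemma c22_dq (ha : 0 < a) (hb : 0 < b) : Hq (c22 a b) (c22q a b) := by
  intro q x hq hx hx1
  have hS := (cS_pos ha hb hq hx hx1).ne'
  have h := ((hasDerivAt_const q (b ^ 2 * (a + b) ^ 2 * x ^ 2)).fun_div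
    (cS_dq a b q x) hS).fun_add ((cB_d a b q).mul_const x)
  refine h.congr_deriv ?_
  unfold c22q; ring

lemma c22_dx (ha : 0 < a) (hb : 0 < b) : Hx (c22 a b) (c22x a b) := by
  intro q x hq hx hx1
  have hS := (cS_pos ha hb hq hx hx1).ne'
  have h := ((((hasDerivAt_id' x).fun_pow 2).const_mul (b ^ 2 * (a + b) ^ 2)).fun_div
    (cS_dx a b q x) hS).fun_add ((hasDerivAt_id' x).const_mul (cB a b q))
  refine h.congr_deriv ?_
  unfold c22x; push_cast; field_simp

lemma c12_dq (ha : 0 < a) (hb : 0 < b) : Hq (c12 a b) (c12q a b) := by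
  intro q x hq hx hx1
  have hS := (cS_pos ha hb hq hx hx1).ne'
  have h := (hasDerivAt_const q (a * b * (a + b) ^ 2 * (x * (1 - x)))).fun_div (cS_dq a b q x) hS
  refine h.congr_deriv ?_
  unfold c12q; ring

lemma c12_dx (ha : 0 < a) (hb : 0 < b) : Hx (c12 a b) (c12x a b) := by
  intro q x hq hx hx1
  have hS := (cS_pos ha hb hq hx hx1).ne'
  have h := (((hasDerivAt_id' x).fun_mul (y_d x)).const_mul (a * b * (a + b) ^ 2)).fun_div
    (cS_dx a b q x) hS
  refine h.congr_deriv ?_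
  unfold c12x; field_simp; ring

lemma cF_dq (ha : 0 < a) (hb : 0 < b) (hab : a ≠ b) : Hq (cF a b) (cFq a b) := by
  intro q x hq hx hx1
  have hS := (cS_pos ha hb hq hx hx1).ne'
  have hd : a - b ≠ 0 := sub_ne_zero.2 hab
  have h := ((((cB_d a b q).const_mul (a * (a ^ 2 - b ^ 2))).mul_const x).fun_sub
      (((hasDerivAt_id' q).const_mul a).fun_mul
        ((hasDerivAt_id' q).const_add (2 * a ^ 2 + 2 * a * b)))).div_const ((a - b) ^ 2)
  have h2 := ((((cA_d a b q).fun_pow 2).const_mul a).fun_mul (cB_d a b q)).fun_div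
    ((cS_dq a b q x).mul_const ((a - b) ^ 2)) (by positivity)
  refine (h.fun_add h2).congr_deriv ?_
  unfold cFq; push_cast; field_simp; unfold cS cA cB; ring

lemma cF_dx (ha : 0 < a) (hb : 0 < b) (hab : a ≠ b) : Hx (cF a b) (cFx a b) := by
  intro q x hq hx hx1
  have hS := (cS_pos ha hb hq hx hx1).ne'
  have hd : a - b ≠ 0 := sub_ne_zero.2 hab
  have h := (((hasDerivAt_id' x).const_mul (a * (a ^ 2 - b ^ 2) * cB a b q)).sub_const
      (a * q * (2 * a ^ 2 + 2 * a * b + q))).div_const ((a - b) ^ 2)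
  have h2 := (hasDerivAt_const x (a * cA a b q ^ 2 * cB a b q)).fun_div
    ((cS_dx a b q x).mul_const ((a - b) ^ 2)) (by positivity)
  refine (h.fun_add h2).congr_deriv ?_
  unfold cFx; field_simp; unfold cS cA cB; ring

lemma cP_dq (ha : 0 < a) (hb : 0 < b) (hab : a ≠ b) : Hq (cP a b) (cPq a b) := by
  intro q x hq hx hx1
  have hS := (cS_pos ha hb hq hx hx1).ne'
  have hd : a - b ≠ 0 := sub_ne_zero.2 hab
  have h := ((((hasDerivAt_id' q).const_mul b).fun_mul
        ((hasDerivAt_id' q).const_add ((a + b) ^ 2))).fun_sub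
      (((cA_d a b q).const_mul (b * (a ^ 2 - b ^ 2))).mul_const x)).div_const
      ((a - b) ^ 2)
  have h2 := (((cA_d a b q).const_mul b).fun_mul ((cB_d a b q).fun_pow 2)).fun_div
    ((cS_dq a b q x).mul_const ((a - b) ^ 2)) (by positivity)
  refine (h.fun_sub h2).congr_deriv ?_
  unfold cPq; push_cast; field_simp; unfold cS cA cB; ring

lemma cP_dx (ha : 0 < a) (hb : 0 < b) (hab : a ≠ b) : Hx (cP a b) (cPx a b) := by
  intro q x hq hx hx1
  have hS := (cS_pos ha hb hq hx hx1).ne'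
  have hd : a - b ≠ 0 := sub_ne_zero.2 hab
  have h := (((hasDerivAt_id' x).const_mul (b * (a ^ 2 - b ^ 2) * cA a b q)).const_sub
      (b * q * ((a + b) ^ 2 + q))).div_const ((a - b) ^ 2)
  have h2 := (hasDerivAt_const x (b * cA a b q * cB a b q ^ 2)).fun_div
    ((cS_dx a b q x).mul_const ((a - b) ^ 2)) (by positivity)
  refine (h.fun_sub h2).congr_deriv ?_
  unfold cPx; field_simp; unfold cS cA cB; ring

/-- Division by `Φ₀²`. -/
lemma prime_dq (ha : 0 < a) (hb : 0 < b) {G Gq : ℝ → ℝ → ℝ} (hG : Hq G Gq) :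
    Hq (fun q x => G q x / cE a b q x ^ 2)
      (fun q x => (Gq q x - G q x * cLq a b q x / 2) / cE a b q x ^ 2) := by
  intro q x hq hx hx1
  have hE : cE a b q x ≠ 0 := (Real.exp_pos _).ne'
  have h := (hG q x hq hx hx1).fun_div ((cE_dq ha hb q x hq hx hx1).fun_pow 2) (pow_ne_zero 2 hE)
  refine h.congr_deriv ?_
  unfold cEq; push_cast; field_simp; ring

lemma prime_dx (ha : 0 < a) (hb : 0 < b) {G Gx : ℝ → ℝ → ℝ} (hG : Hx G Gx) :
    Hx (fun q x => G q x / cE a b q x ^ 2)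
      (fun q x => (Gx q x - G q x * cLx a b q x / 2) / cE a b q x ^ 2) := by
  intro q x hq hx hx1
  have hE : cE a b q x ≠ 0 := (Real.exp_pos _).ne'
  have h := (hG q x hq hx hx1).fun_div ((cE_dx ha hb q x hq hx hx1).fun_pow 2) (pow_ne_zero 2 hE)
  refine h.congr_deriv ?_
  unfold cEx; push_cast; field_simp; ring

/-! Identification of the frozen functions with lifts. -/

lemma Sig_eq (a b r θ : ℝ) : Sig a b r θ = cS a b (r ^ 2) (Real.cos θ ^ 2) := by
  unfold Sig cS
  rw [Real.sin_sq]; ring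

lemma sig11_eq (a b : ℝ) : EqDom (sig11 a b) (lift (c11 a b)) := by
  intro r θ _ _
  have h : Real.sin θ ^ 4 = (1 - Real.cos θ ^ 2) ^ 2 := by rw [← Real.sin_sq]; ring
  unfold sig11 lift c11
  rw [Sig_eq, h, Real.sin_sq]; rfl

lemma sig22_eq (a b : ℝ) : EqDom (sig22 a b) (lift (c22 a b)) := by
  intro r θ _ _
  unfold sig22 lift c22
  rw [Sig_eq]
  have h : Real.cos θ ^ 4 = (Real.cos θ ^ 2) ^ 2 := by ring
  rw [h]; rfl

lemma sig12_eq (a b : ℝ) : EqDom (sig12 a b) (lift (c12 a b)) := by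
  intro r θ _ _
  unfold sig12 lift c12
  rw [Sig_eq, Real.sin_sq]; ring

lemma omegaPhi_eq (a b : ℝ) : EqDom (omegaPhi a b) (lift (cF a b)) := by
  intro r θ _ _
  unfold omegaPhi lift cF
  rw [Sig_eq]; rfl

lemma omegaPsi_eq (a b : ℝ) : EqDom (omegaPsi a b) (lift (cP a b)) := by
  intro r θ _ _
  unfold omegaPsi lift cP
  rw [Sig_eq]; rfl

lemma det_eq {q x : ℝ} (hS : cS a b q x ≠ 0) :
    c11 a b q x * c22 a b q x - c12 a b q x ^ 2 = x * (1 - x) * cN a b q x / cS a b q x := by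
  unfold c11 c22 c12 cN
  field_simp; ring

lemma cE_pow4 (ha : 0 < a) (hb : 0 < b) {q x : ℝ} (hq : 0 < q) (hx : 0 < x) (hx1 : x < 1) :
    cE a b q x ^ 4 = cN a b q x / (cS a b q x * q ^ 2) := by
  have hS := cS_pos ha hb hq hx hx1
  have hN := cN_pos ha hb hq hx hx1
  unfold cE
  rw [← Real.exp_nat_mul]
  have : ((4 : ℕ) : ℝ) * (cL a b q x / 4) = Real.log (cN a b q x / (cS a b q x * q ^ 2)) := by
    rw [Real.log_div hN.ne' (by positivity), Real.log_mul hS.ne' (by positivity), Real.log_pow]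
    unfold cL; push_cast; ring
  rw [this, Real.exp_log (by positivity)]

lemma Phi0_eq (ha : 0 < a) (hb : 0 < b) : EqDom (Phi0 a b) (lift (cE a b)) := by
  intro r θ hr hθ
  obtain ⟨h1, h2, h3, h4⟩ := dom_facts hθ
  have hq : 0 < r ^ 2 := by positivity
  have hS := cS_pos ha hb hq h3 h4
  have hE4 := cE_pow4 ha hb hq h3 h4
  have hE : 0 < cE a b (r ^ 2) (Real.cos θ ^ 2) := Real.exp_pos _
  unfold Phi0 detSig
  rw [sig11_eq a b r θ hr hθ, sig22_eq a b r θ hr hθ, sig12_eq a b r θ hr hθ]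
  unfold lift
  rw [det_eq hS.ne']
  have e1 : Real.cos θ ^ 2 * (1 - Real.cos θ ^ 2) * cN a b (r ^ 2) (Real.cos θ ^ 2) /
      cS a b (r ^ 2) (Real.cos θ ^ 2) =
      (rho r θ * cE a b (r ^ 2) (Real.cos θ ^ 2) ^ 2) ^ 2 := by
    have : (rho r θ * cE a b (r ^ 2) (Real.cos θ ^ 2) ^ 2) ^ 2 =
      (r ^ 2) ^ 2 * Real.sin θ ^ 2 * Real.cos θ ^ 2 * cE a b (r ^ 2) (Real.cos θ ^ 2) ^ 4 := by
      unfold rho; ring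
    rw [this, hE4, Real.sin_sq]
    field_simp
  have hrho : 0 < rho r θ := by unfold rho; positivity
  rw [e1, Real.sqrt_sq (by positivity), mul_div_cancel_left₀ _ hrho.ne', Real.sqrt_sq hE.le]

lemma sig11'_eq (ha : 0 < a) (hb : 0 < b) :
    EqDom (sig11' a b) (lift fun q x => c11 a b q x / cE a b q x ^ 2) := by
  intro r θ hr hθ
  unfold sig11'
  rw [sig11_eq a b r θ hr hθ, Phi0_eq ha hb r θ hr hθ]; rfl

lemma sig22'_eq (ha : 0 < a) (hb : 0 < b) :
    EqDom (sig22' a b) (lift fun q x => c22 a b q x / cE a b q x ^ 2) := by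
  intro r θ hr hθ
  unfold sig22'
  rw [sig22_eq a b r θ hr hθ, Phi0_eq ha hb r θ hr hθ]; rfl

lemma sig12'_eq (ha : 0 < a) (hb : 0 < b) :
    EqDom (sig12' a b) (lift fun q x => c12 a b q x / cE a b q x ^ 2) := by
  intro r θ hr hθ
  unfold sig12'
  rw [sig12_eq a b r θ hr hθ, Phi0_eq ha hb r θ hr hθ]; rfl

lemma Ufun_eq (ha : 0 < a) (hb : 0 < b) : EqDom (Ufun a b) (lift (cU a b)) := by
  intro r θ hr hθ
  obtain ⟨h1, h2, h3, h4⟩ := dom_facts hθ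
  have hq : 0 < r ^ 2 := by positivity
  have hS := cS_pos ha hb hq h3 h4
  have hE : 0 < cE a b (r ^ 2) (Real.cos θ ^ 2) := Real.exp_pos _
  unfold Ufun
  rw [Phi0_eq ha hb r θ hr hθ, Sig_eq]
  unfold lift
  have : r ^ 4 = (r ^ 2) ^ 2 := by ring
  rw [this, Real.log_div hS.ne' (by positivity), Real.log_mul (by positivity) (by positivity),
    Real.log_pow (r ^ 2), Real.log_pow (cE _ _ _ _)]
  have : Real.log (cE a b (r ^ 2) (Real.cos θ ^ 2)) = cL a b (r ^ 2) (Real.cos θ ^ 2) / 4 := by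
    unfold cE; rw [Real.log_exp]
  rw [this]
  unfold cU; push_cast; ring

lemma J_q {q x : ℝ} (hS0 : cS a b q x ≠ 0) :
    c11q a b q x * c22q a b q x - c12q a b q x ^ 2 =
      x * (1 - x) * (cS a b q x ^ 2 - (a + b) ^ 2 * (a ^ 2 * (1 - x) + b ^ 2 * x)) /
        cS a b q x ^ 2 := by
  unfold c11q c22q c12q
  field_simp
  ring

/-- Numerator of the angular part of the scalar curvature bracket. -/
def cM (a b q x : ℝ) : ℝ := cA a b q * cB a b q * cS a b q x ^ 2 +
  (a + b) ^ 2 * cS a b q x * (2 * a ^ 2 * (1 - x) * cB a b q + 2 * b ^ 2 * x * cA a b q) +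
  (a + b) ^ 2 * (a ^ 2 - b ^ 2) * (a ^ 2 * (1 - x) ^ 2 * cB a b q - b ^ 2 * x ^ 2 * cA a b q) +
  a ^ 2 * b ^ 2 * ((a + b) ^ 2) ^ 2

lemma J_x {q x : ℝ} (hS0 : cS a b q x ≠ 0) :
    c11x a b q x * c22x a b q x - c12x a b q x ^ 2 = -cM a b q x / cS a b q x ^ 2 := by
  unfold c11x c22x c12x cM
  field_simp
  unfold cS cA cB
  ring

lemma D_q {q x : ℝ} (hS0 : cS a b q x ≠ 0) (hN0 : cN a b q x ≠ 0) (hq : q ≠ 0) :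
    c11q a b q x * c22 a b q x + c11 a b q x * c22q a b q x - 2 * c12 a b q x * c12q a b q x =
      x * (1 - x) * cN a b q x / cS a b q x * (cLq a b q x + 2 / q) := by
  have : x * (1 - x) * cN a b q x / cS a b q x * (cLq a b q x + 2 / q) =
    x * (1 - x) * (cNq a b q x / cS a b q x - cN a b q x / cS a b q x ^ 2) := by
    unfold cLq; field_simp; ring
  rw [this]
  unfold c11 c22 c12 c11q c22q c12q cN cNq
  field_simp
  ring

lemma D_x {q x : ℝ} (hS0 : cS a b q x ≠ 0) (hN0 : cN a b q x ≠ 0)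
    (hx : x ≠ 0) (hy : 1 - x ≠ 0) :
    c11x a b q x * c22 a b q x + c11 a b q x * c22x a b q x - 2 * c12 a b q x * c12x a b q x =
      x * (1 - x) * cN a b q x / cS a b q x * (cLx a b q x + (1 - 2 * x) / (x * (1 - x))) := by
  have : x * (1 - x) * cN a b q x / cS a b q x *
      (cLx a b q x + (1 - 2 * x) / (x * (1 - x))) =
    x * (1 - x) * (cNx a b q / cS a b q x - (a ^ 2 - b ^ 2) * cN a b q x / cS a b q x ^ 2)
      + (1 - 2 * x) * cN a b q x / cS a b q x := by
    unfold cLx; field_simp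
  rw [this]
  unfold c11 c22 c12 c11x c22x c12x cN cNx
  field_simp
  unfold cS cA cB
  ring

/-- Bracket in the extrinsic curvature. -/
def cW (a b q x : ℝ) : ℝ :=
  q * (a ^ 2 - b ^ 2) ^ 2 * (x * (1 - x)) * (b ^ 2 * x * cA a b q + a ^ 2 * (1 - x) * cB a b q) +
  (a ^ 2 * b ^ 2 * (a + b) ^ 2 * (x * (1 - x)) * cS a b q x * (a ^ 2 - b ^ 2) ^ 2 +
    b ^ 2 * x * cA a b q ^ 3 * (cS a b q x + cB a b q) ^ 2 +
    a ^ 2 * (1 - x) * cB a b q ^ 3 * (cS a b q x + cA a b q) ^ 2) / q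

lemma K_eq {q x : ℝ} (hS0 : cS a b q x ≠ 0) (hq : q ≠ 0) :
    c11 a b q x * (q * cPq a b q x * cPq a b q x + x * (1 - x) * (cPx a b q x * cPx a b q x) / q) +
    c22 a b q x * (q * cFq a b q x * cFq a b q x + x * (1 - x) * (cFx a b q x * cFx a b q x) / q) -
    2 * c12 a b q x *
      (q * cFq a b q x * cPq a b q x + x * (1 - x) * (cFx a b q x * cPx a b q x) / q) =
    (a + b) ^ 4 * x ^ 2 * (1 - x) ^ 2 * cW a b q x / cS a b q x ^ 4 := by
  have hd : a ^ 2 - b ^ 2 = cA a b q - cB a b q := by unfold cA cB; ring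
  unfold c11 c22 c12 cPq cPx cFq cFx cW
  rw [hd]
  field_simp
  ring

set_option maxHeartbeats 4000000 in
lemma key {q x : ℝ} (hS0 : cS a b q x ≠ 0) (hN0 : cN a b q x ≠ 0) (hq : q ≠ 0) :
    2 * (4 * cNq a b q x / cN a b q x +
        4 * q * (cNqq a b q x / cN a b q x - cNq a b q x ^ 2 / cN a b q x ^ 2) +
        (4 * (x * (1 - x)) * (-cNx a b q ^ 2 / cN a b q x ^ 2) -
          2 * (2 * x - 1) * (cNx a b q / cN a b q x)) / q) +
      4 * (4 * cLq a b q x - 2 * (2 * x - 1) * cLx a b q x / q) +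
      4 * (q * cLq a b q x ^ 2 + x * (1 - x) * cLx a b q x ^ 2 / q) -
      4 * (q * (cS a b q x ^ 2 - (a + b) ^ 2 * (a ^ 2 * (1 - x) + b ^ 2 * x)) - cM a b q x / q) /
        (cN a b q x * cS a b q x) +
      4 * (a + b) ^ 4 * cW a b q x / (cS a b q x ^ 2 * cN a b q x ^ 2) = 0 := by
  unfold cLq cLx cW
  field_simp
  unfold cM cNq cNqq cNx cN cS cA cB
  ring

lemma assemble {q x e S N P Lq Lx Lqq Lxx Uq Ux Uqq Uxx s11 s22 s12 s11q s22q s12q s11x s22x s12x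
    Fq Fx Pq Px Jq Jx T : ℝ}
    (hq : q ≠ 0) (hx : x ≠ 0) (hy : 1 - x ≠ 0) (he : e ≠ 0) (hS : S ≠ 0) (hN : N ≠ 0)
    (he4 : e ^ 4 = N / (S * q ^ 2))
    (hD : s11 * s22 - s12 ^ 2 = x * (1 - x) * N / S)
    (hDq : s11q * s22 + s11 * s22q - 2 * s12 * s12q = x * (1 - x) * N / S * (Lq + 2 / q))
    (hDx : s11x * s22 + s11 * s22x - 2 * s12 * s12x =
      x * (1 - x) * N / S * (Lx + (1 - 2 * x) / (x * (1 - x))))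
    (hJq : s11q * s22q - s12q ^ 2 = x * (1 - x) * Jq)
    (hJx : s11x * s22x - s12x ^ 2 = Jx)
    (hK : s11 * (q * Pq * Pq + x * (1 - x) * (Px * Px) / q) +
      s22 * (q * Fq * Fq + x * (1 - x) * (Fx * Fx) / q) -
      2 * s12 * (q * Fq * Pq + x * (1 - x) * (Fx * Px) / q) = x ^ 2 * (1 - x) ^ 2 * T)
    (hkey : 2 * (4 * (q * Lqq + Lq) + 8 * P +
        (4 * (x * (1 - x)) * Lxx - 2 * (2 * x - 1) * Lx) / q) +
      4 * (4 * Lq - 2 * (2 * x - 1) * Lx / q) +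
      4 * (q * Lq ^ 2 + x * (1 - x) * Lx ^ 2 / q) -
      4 * (q * Jq + Jx / q) * S / N + 4 * T * S ^ 2 / N ^ 2 = 0)
    (hU : 4 * q ^ 2 * Uqq + 4 * q * Uq + 4 * (x * (1 - x)) * Uxx - 2 * (2 * x - 1) * Ux =
      4 * q * P - (4 * q ^ 2 * Lqq + 4 * q * Lq + 4 * (x * (1 - x)) * Lxx
        - 2 * (2 * x - 1) * Lx) / 4) :
    4 * q * (e * (Lqq / 4 + Lq ^ 2 / 16)) + 8 * (e * (Lq / 4)) +
      (4 * (x * (1 - x)) * (e * (Lxx / 4 + Lx ^ 2 / 16)) - 4 * (2 * x - 1) * (e * (Lx / 4))) / q -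
    q * (-2 * ((4 * q ^ 2 * Uqq + 4 * q * Uq + 4 * (x * (1 - x)) * Uxx
        - 2 * (2 * x - 1) * Ux) / q ^ 2) +
      (4 * (q * ((s11q - s11 * Lq / 2) / e ^ 2) * ((s22q - s22 * Lq / 2) / e ^ 2) +
        x * (1 - x) * (((s11x - s11 * Lx / 2) / e ^ 2) * ((s22x - s22 * Lx / 2) / e ^ 2)) / q) / q -
      4 * (q * ((s12q - s12 * Lq / 2) / e ^ 2) * ((s12q - s12 * Lq / 2) / e ^ 2) +
        x * (1 - x) * (((s12x - s12 * Lx / 2) / e ^ 2) * ((s12x - s12 * Lx / 2) / e ^ 2)) / q) / q)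
        / (2 * (q ^ 2 * (x * (1 - x))))) / 6 * e +
    (q / (2 * (q ^ 2 * (x * (1 - x))) ^ 2) *
      (s11 / e ^ 2 * (4 * (q * Pq * Pq + x * (1 - x) * (Px * Px) / q) / q) +
       s22 / e ^ 2 * (4 * (q * Fq * Fq + x * (1 - x) * (Fx * Fx) / q) / q) -
       2 * (s12 / e ^ 2) * (4 * (q * Fq * Pq + x * (1 - x) * (Fx * Px) / q) / q))) / (6 * e ^ 5)
    = 0 := by
  have hw : (e ^ 4)⁻¹ = S * q ^ 2 / N := by rw [he4, inv_div]
  have hRb : (4 * (q * ((s11q - s11 * Lq / 2) / e ^ 2) * ((s22q - s22 * Lq / 2) / e ^ 2) +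
        x * (1 - x) * (((s11x - s11 * Lx / 2) / e ^ 2) * ((s22x - s22 * Lx / 2) / e ^ 2)) / q) / q -
      4 * (q * ((s12q - s12 * Lq / 2) / e ^ 2) * ((s12q - s12 * Lq / 2) / e ^ 2) +
        x * (1 - x) * (((s12x - s12 * Lx / 2) / e ^ 2) * ((s12x - s12 * Lx / 2) / e ^ 2)) / q) / q)
      = (e ^ 4)⁻¹ * (4 / q) * (q * ((s11q * s22q - s12q ^ 2) -
          Lq / 2 * (s11q * s22 + s11 * s22q - 2 * s12 * s12q) +
          Lq ^ 2 / 4 * (s11 * s22 - s12 ^ 2)) + x * (1 - x) / q * ((s11x * s22x - s12x ^ 2) -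
          Lx / 2 * (s11x * s22 + s11 * s22x - 2 * s12 * s12x) +
          Lx ^ 2 / 4 * (s11 * s22 - s12 ^ 2))) := by
    field_simp; ring
  have hKb : (q / (2 * (q ^ 2 * (x * (1 - x))) ^ 2) *
      (s11 / e ^ 2 * (4 * (q * Pq * Pq + x * (1 - x) * (Px * Px) / q) / q) +
       s22 / e ^ 2 * (4 * (q * Fq * Fq + x * (1 - x) * (Fx * Fx) / q) / q) -
       2 * (s12 / e ^ 2) * (4 * (q * Fq * Pq + x * (1 - x) * (Fx * Px) / q) / q))) / (6 * e ^ 5)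
      = e * ((e ^ 4)⁻¹) ^ 2 * (1 / (3 * q ^ 4 * x ^ 2 * (1 - x) ^ 2)) *
       (s11 * (q * Pq * Pq + x * (1 - x) * (Px * Px) / q) +
      s22 * (q * Fq * Fq + x * (1 - x) * (Fx * Fx) / q) -
      2 * s12 * (q * Fq * Pq + x * (1 - x) * (Fx * Px) / q)) := by
    generalize q * Pq * Pq + x * (1 - x) * (Px * Px) / q = X
    generalize q * Fq * Fq + x * (1 - x) * (Fx * Fx) / q = Y
    generalize q * Fq * Pq + x * (1 - x) * (Fx * Px) / q = Z
    field_simp; ring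
  rw [hRb, hKb, hK, hD, hDq, hDx, hJq, hJx, hU, hw]
  refine Eq.trans ?_ (mul_eq_zero_of_right (e / 12) hkey)
  field_simp
  ring

end

end MPaux


open MP in
/-- The extreme Myers–Perry conformal factor solves the Lichnerowicz equation
(`a ≠ b`): `Δ₄Φ₀ − (R̃₀/6)Φ₀ + K̃₀²/(6Φ₀⁵) = 0` for all `r > 0`, `θ ∈ (0, π/2)`. -/
theorem lichnerowicz_Phi0 (a b : ℝ) (ha : 0 < a) (hb : 0 < b) (hab : a ≠ b) :
    ∀ r θ : ℝ, 0 < r → θ ∈ Set.Ioo 0 (Real.pi / 2) →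
      Delta4 (Phi0 a b) r θ - Rt0 a b r θ / 6 * Phi0 a b r θ +
          Ksq a b r θ / (6 * Phi0 a b r θ ^ 5) = 0 := by
  intro r θ hr hθ
  obtain ⟨h1, h2, h3, h4⟩ := MPaux.dom_facts hθ
  have hq0 : 0 < r ^ 2 := by positivity
  obtain ⟨q, hq⟩ : ∃ q, q = r ^ 2 := ⟨_, rfl⟩
  obtain ⟨x, hx⟩ : ∃ x, x = Real.cos θ ^ 2 := ⟨_, rfl⟩
  rw [← hq] at hq0
  rw [← hx] at h3 h4
  have hy : 1 - x ≠ 0 := by linarith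
  have hS := (MPaux.cS_pos ha hb hq0 h3 h4).ne'
  have hN := (MPaux.cN_pos ha hb hq0 h3 h4).ne'
  have hrho : rho r θ ^ 2 = q ^ 2 * (x * (1 - x)) := by
    unfold rho
    rw [hq, hx, ← Real.sin_sq]; ring
  have hrho4 : rho r θ ^ 4 = (q ^ 2 * (x * (1 - x))) ^ 2 := by rw [← hrho]; ring
  have hPhi : Phi0 a b r θ = MPaux.cE a b q x := by
    rw [MPaux.Phi0_eq ha hb r θ hr hθ, hq, hx]; rfl
  have h11 : sig11' a b r θ = MPaux.c11 a b q x / MPaux.cE a b q x ^ 2 := by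
    rw [MPaux.sig11'_eq ha hb r θ hr hθ, hq, hx]; rfl
  have h22 : sig22' a b r θ = MPaux.c22 a b q x / MPaux.cE a b q x ^ 2 := by
    rw [MPaux.sig22'_eq ha hb r θ hr hθ, hq, hx]; rfl
  have h12 : sig12' a b r θ = MPaux.c12 a b q x / MPaux.cE a b q x ^ 2 := by
    rw [MPaux.sig12'_eq ha hb r θ hr hθ, hq, hx]; rfl
  have hE : MPaux.cE a b q x ≠ 0 := (Real.exp_pos _).ne'
  unfold Rt0 Ksq
  rw [h11, h22, h12, hPhi, hrho, hrho4, ← hq,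
    MPaux.Delta4_lift (MPaux.Phi0_eq ha hb) (MPaux.cE_dq ha hb) (MPaux.cE_dx ha hb)
      (MPaux.cEq_dq ha hb) (MPaux.cEx_dx ha hb) hr hθ hq hx,
    MPaux.Delta2_lift (MPaux.Ufun_eq ha hb) (MPaux.cU_dq ha hb) (MPaux.cU_dx ha hb)
      (MPaux.cUq_dq ha hb) (MPaux.cUx_dx ha hb) hr hθ hq hx,
    MPaux.dInner_lift (MPaux.sig11'_eq ha hb) (MPaux.sig22'_eq ha hb)
      (MPaux.prime_dq ha hb (MPaux.c11_dq ha hb)) (MPaux.prime_dx ha hb (MPaux.c11_dx ha hb))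
      (MPaux.prime_dq ha hb (MPaux.c22_dq ha hb)) (MPaux.prime_dx ha hb (MPaux.c22_dx ha hb))
      hr hθ hq hx,
    MPaux.dInner_lift (MPaux.sig12'_eq ha hb) (MPaux.sig12'_eq ha hb)
      (MPaux.prime_dq ha hb (MPaux.c12_dq ha hb)) (MPaux.prime_dx ha hb (MPaux.c12_dx ha hb))
      (MPaux.prime_dq ha hb (MPaux.c12_dq ha hb)) (MPaux.prime_dx ha hb (MPaux.c12_dx ha hb))
      hr hθ hq hx,
    MPaux.dInner_lift (MPaux.omegaPsi_eq a b) (MPaux.omegaPsi_eq a b)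
      (MPaux.cP_dq ha hb hab) (MPaux.cP_dx ha hb hab)
      (MPaux.cP_dq ha hb hab) (MPaux.cP_dx ha hb hab) hr hθ hq hx,
    MPaux.dInner_lift (MPaux.omegaPhi_eq a b) (MPaux.omegaPhi_eq a b)
      (MPaux.cF_dq ha hb hab) (MPaux.cF_dx ha hb hab)
      (MPaux.cF_dq ha hb hab) (MPaux.cF_dx ha hb hab) hr hθ hq hx,
    MPaux.dInner_lift (MPaux.omegaPhi_eq a b) (MPaux.omegaPsi_eq a b)
      (MPaux.cF_dq ha hb hab) (MPaux.cF_dx ha hb hab)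
      (MPaux.cP_dq ha hb hab) (MPaux.cP_dx ha hb hab) hr hθ hq hx]
  refine MPaux.assemble (S := MPaux.cS a b q x) (N := MPaux.cN a b q x)
    (P := (4 / MPaux.cS a b q x - 4 * q / MPaux.cS a b q x ^ 2 +
      (-(4 * (x * (1 - x)) * (a ^ 2 - b ^ 2) ^ 2 / MPaux.cS a b q x ^ 2) -
        2 * (2 * x - 1) * ((a ^ 2 - b ^ 2) / MPaux.cS a b q x)) / q) / 8)
    (Jq := (MPaux.cS a b q x ^ 2 - (a + b) ^ 2 * (a ^ 2 * (1 - x) + b ^ 2 * x)) /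
      MPaux.cS a b q x ^ 2)
    (Jx := -MPaux.cM a b q x / MPaux.cS a b q x ^ 2)
    (T := (a + b) ^ 4 * MPaux.cW a b q x / MPaux.cS a b q x ^ 4)
    hq0.ne' h3.ne' hy hE hS hN (MPaux.cE_pow4 ha hb hq0 h3 h4) (MPaux.det_eq hS)
    (MPaux.D_q hS hN hq0.ne') (MPaux.D_x hS hN h3.ne' hy) ?_ (MPaux.J_x hS) ?_ ?_ ?_
  · rw [MPaux.J_q hS]; ring
  · rw [MPaux.K_eq hS hq0.ne']; ring
  · rw [← MPaux.key hS hN hq0.ne']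
    have := hq0.ne'
    unfold MPaux.cLqq MPaux.cLxx MPaux.cLq MPaux.cLx
    field_simp
    ring
  · have := hq0.ne'
    unfold MPaux.cUqq MPaux.cUxx MPaux.cUq MPaux.cUx
    field_simp
    ring

end
end
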